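/- arXiv:2410.15557 — 8 statements merged into one kernel-verified Lean document; each statement's English description precedes it below -/
import Mathlib

section
/- For a finite discounted multi-objective MDP with initial distribution μ satisfying μ(s) > 0 for every state s, the set of long-term returns J(μ) = {J^π(μ) : π a stationary policy} equals the convex hull of the finite set {J^π(μ) : π a deterministic stationary policy}. In particular, J(μ) is a compact convex polytope and every extreme point of J(μ) is the long-term return J^π(μ) of some deterministic stationary policy π. -/
open Finset

/-- A stationary policy: nonnegative and sums to one at every state. -/
def IsPolicy {S A : Type*} [Fintype A] (π : S → A → ℝ) : Prop :=
  (∀ s a, 0 ≤ π s a) ∧ (∀ s, ∑ a, π s a = 1)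

/-- A deterministic stationary policy: a policy selecting one action with probability 1
at each state. -/
def IsDetPolicy {S A : Type*} [Fintype A] (π : S → A → ℝ) : Prop :=
  IsPolicy π ∧ ∀ s, ∃ a, π s a = 1

/-- `d` solves the discounted flow equations of the policy `π` started from `μ`. -/
def IsOccupancy {S A : Type*} [Fintype S] [Fintype A] (P : S → A → S → ℝ) (γ : ℝ) (μ : S → ℝ)
    (π : S → A → ℝ) (d : S → ℝ) : Prop :=
  ∀ s', d s' = μ s' + γ * ∑ s, d s * ∑ a, π s a * P s a s'

/-- Pushing `d` through a stochastic kernel does not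
increase its `ℓ¹` norm. -/
lemma sum_abs_sum_mul_le {S : Type*} [Fintype S] (Q : S → S → ℝ) (hQ0 : ∀ s s', 0 ≤ Q s s')
    (hQ1 : ∀ s, ∑ s', Q s s' = 1) (d : S → ℝ) :
    ∑ s', |∑ s, d s * Q s s'| ≤ ∑ s, |d s| := by
  calc ∑ s', |∑ s, d s * Q s s'| ≤ ∑ s', ∑ s, |d s| * Q s s' := by
        refine sum_le_sum fun s' _ => (abs_sum_le_sum_abs _ _).trans (le_of_eq ?_)
        exact sum_congr rfl fun s _ => by rw [abs_mul, abs_of_nonneg (hQ0 s s')]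
    _ = ∑ s, |d s| := by
        rw [sum_comm]
        exact sum_congr rfl fun s _ => by rw [← mul_sum, hQ1, mul_one]

/-- The discounted flow equation of a stochastic kernel has a solution dominating `μ`. -/
lemma exists_discounted_flow {S : Type*} [Fintype S] (Q : S → S → ℝ)
    (hQ0 : ∀ s s', 0 ≤ Q s s') (hQ1 : ∀ s, ∑ s', Q s s' = 1) (γ : ℝ) (hγ0 : 0 ≤ γ) (hγ1 : γ < 1)
    (μ : S → ℝ) (hμ : ∀ s, 0 ≤ μ s) :
    ∃ d : S → ℝ, (∀ s, μ s ≤ d s) ∧ ∀ s', d s' = μ s' + γ * ∑ s, d s * Q s s' := by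
  let T : (S → ℝ) →ₗ[ℝ] (S → ℝ) :=
    { toFun := fun d s' => d s' - γ * ∑ s, d s * Q s s'
      map_add' := fun x y => by
        ext s'
        simp only [Pi.add_apply, add_mul, sum_add_distrib]
        ring
      map_smul' := fun c x => by
        ext s'
        simp only [Pi.smul_apply, smul_eq_mul, RingHom.id_apply, mul_assoc, ← mul_sum]
        ring }
  have hinj : Function.Injective T := by
    refine (injective_iff_map_eq_zero T).2 fun d hd => ?_
    have hd' : ∀ s', d s' = γ * ∑ s, d s * Q s s' := fun s' => sub_eq_zero.1 (congrFun hd s')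
    have h1 : ∑ s', |d s'| = γ * ∑ s', |∑ s, d s * Q s s'| := by
      rw [mul_sum]
      exact sum_congr rfl fun s' _ => by
        conv_lhs => rw [hd' s', abs_mul, abs_of_nonneg hγ0]
    have h2 := mul_le_mul_of_nonneg_left (sum_abs_sum_mul_le Q hQ0 hQ1 d) hγ0
    have h0 : 0 ≤ ∑ s, |d s| := sum_nonneg fun _ _ => abs_nonneg _
    have h3 : ∑ s, |d s| = 0 := by nlinarith
    ext s
    exact abs_eq_zero.1 ((sum_eq_zero_iff_of_nonneg fun _ _ => abs_nonneg _).1 h3 s (mem_univ s))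
  obtain ⟨d, hd⟩ := LinearMap.injective_iff_surjective.1 hinj μ
  have hd' : ∀ s', d s' = μ s' + γ * ∑ s, d s * Q s s' := fun s' => by
    have : d s' - γ * ∑ s, d s * Q s s' = μ s' := congrFun hd s'
    linarith
  have hsum : ∑ s, d s = ∑ s, μ s + γ * ∑ s, d s := by
    calc ∑ s', d s' = ∑ s', (μ s' + γ * ∑ s, d s * Q s s') := sum_congr rfl fun s' _ => hd' s'
      _ = ∑ s, μ s + γ * ∑ s, d s := by
        rw [sum_add_distrib, ← mul_sum, sum_comm]
        simp only [← mul_sum, hQ1, mul_one]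
  have habs : ∑ s, |d s| ≤ ∑ s, μ s + γ * ∑ s, |d s| := by
    calc ∑ s', |d s'| ≤ ∑ s', (μ s' + γ * |∑ s, d s * Q s s'|) := by
          refine sum_le_sum fun s' _ => ?_
          conv_lhs => rw [hd' s']
          refine (abs_add_le _ _).trans (le_of_eq ?_)
          rw [abs_of_nonneg (hμ s'), abs_mul, abs_of_nonneg hγ0]
      _ ≤ ∑ s, μ s + γ * ∑ s, |d s| := by
          rw [sum_add_distrib, ← mul_sum]
          exact add_le_add le_rfl
            (mul_le_mul_of_nonneg_left (sum_abs_sum_mul_le Q hQ0 hQ1 d) hγ0)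
  have hle : ∑ s, (|d s| - d s) ≤ 0 := by
    rw [sum_sub_distrib]
    nlinarith
  have hnn : ∀ s ∈ (univ : Finset S), 0 ≤ |d s| - d s := fun s _ => sub_nonneg.2 (le_abs_self _)
  have hd0 : ∀ s, 0 ≤ d s := fun s => by
    have := (sum_eq_zero_iff_of_nonneg hnn).1 (le_antisymm hle (sum_nonneg hnn)) s (mem_univ s)
    rw [← sub_eq_zero.1 this]
    exact abs_nonneg _
  refine ⟨d, fun s' => ?_, hd'⟩
  rw [hd' s']
  exact le_add_of_nonneg_right
    (mul_nonneg hγ0 (sum_nonneg fun s _ => mul_nonneg (hd0 s) (hQ0 s s')))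

/-- Every policy has an occupancy that is positive on every state when `μ` is. -/
lemma exists_isOccupancy {S A : Type*} [Fintype S] [Fintype A] (P : S → A → S → ℝ)
    (hP0 : ∀ s a s', 0 ≤ P s a s') (hP1 : ∀ s a, ∑ s', P s a s' = 1)
    (γ : ℝ) (hγ0 : 0 ≤ γ) (hγ1 : γ < 1) (μ : S → ℝ) (hμ : ∀ s, 0 < μ s)
    (π : S → A → ℝ) (hπ : IsPolicy π) :
    ∃ d : S → ℝ, (∀ s, 0 < d s) ∧ IsOccupancy P γ μ π d := by
  obtain ⟨d, hd, hd'⟩ := exists_discounted_flow (fun s s' => ∑ a, π s a * P s a s')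
    (fun s s' => sum_nonneg fun a _ => mul_nonneg (hπ.1 s a) (hP0 s a s'))
    (fun s => by
      rw [sum_comm]
      simp only [← mul_sum, hP1, mul_one]
      exact hπ.2 s)
    γ hγ0 hγ1 μ fun s => (hμ s).le
  exact ⟨d, fun s => (hμ s).trans_le (hd s), hd'⟩

/-- The return of a policy is the integral of the reward against any occupancy. -/
lemma IsOccupancy.sum_smul_value_eq {S A E : Type*} [Fintype S] [Fintype A] [AddCommGroup E]
    [Module ℝ E] {P : S → A → S → ℝ} {γ : ℝ} {μ : S → ℝ} {π : S → A → ℝ} {d : S → ℝ}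
    (hd : IsOccupancy P γ μ π d) (r : S → A → E) (v : S → E)
    (hv : ∀ s, v s = (∑ a, π s a • r s a) + γ • ∑ s', (∑ a, π s a * P s a s') • v s') :
    ∑ s, μ s • v s = ∑ s, ∑ a, (d s * π s a) • r s a := by
  have h1 : ∑ s, d s • v s =
      ∑ s, μ s • v s + γ • ∑ s, ∑ s', (d s * ∑ a, π s a * P s a s') • v s' := by
    calc ∑ s', d s' • v s'
        = ∑ s', (μ s' + γ * ∑ s, d s * ∑ a, π s a * P s a s') • v s' :=
          sum_congr rfl fun s' _ => by rw [← hd s']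
      _ = _ := by
          rw [sum_comm, smul_sum, ← sum_add_distrib]
          exact sum_congr rfl fun s' _ => by rw [add_smul, mul_smul, sum_smul]
  have h2 : ∑ s, d s • v s =
      (∑ s, ∑ a, (d s * π s a) • r s a) +
        γ • ∑ s, ∑ s', (d s * ∑ a, π s a * P s a s') • v s' := by
    rw [smul_sum, ← sum_add_distrib]
    refine sum_congr rfl fun s _ => ?_
    conv_lhs => rw [hv s]
    simp only [smul_add, smul_sum, smul_smul, mul_left_comm]
  exact add_right_cancel (h1.symm.trans h2)

/-- If the state-action occupancy of `π` is a mixture of those of `π₁` and `π₂`, then the mixed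
state occupancy is an occupancy of `π`. -/
lemma IsOccupancy.mix {S A : Type*} [Fintype S] [Fintype A] {P : S → A → S → ℝ} {γ : ℝ}
    {μ : S → ℝ} {π₁ π₂ π : S → A → ℝ} {d₁ d₂ : S → ℝ} (h₁ : IsOccupancy P γ μ π₁ d₁)
    (h₂ : IsOccupancy P γ μ π₂ d₂) {t u : ℝ} (htu : t + u = 1)
    (hπ : ∀ s a, (t * d₁ s + u * d₂ s) * π s a = t * (d₁ s * π₁ s a) + u * (d₂ s * π₂ s a)) :
    IsOccupancy P γ μ π fun s => t * d₁ s + u * d₂ s := by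
  intro s'
  have key : ∑ s, (t * d₁ s + u * d₂ s) * ∑ a, π s a * P s a s' =
      t * ∑ s, d₁ s * ∑ a, π₁ s a * P s a s' + u * ∑ s, d₂ s * ∑ a, π₂ s a * P s a s' := by
    simp only [mul_sum, ← sum_add_distrib]
    refine sum_congr rfl fun s _ => sum_congr rfl fun a _ => ?_
    linear_combination P s a s' * hπ s a
  dsimp only
  rw [key]
  linear_combination t * h₁ s' + u * h₂ s' + μ s' * htu

/-- There are finitely many deterministic stationary policies. -/
lemma finite_setOf_isDetPolicy (S A : Type*) [Finite S] [Fintype A] :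
    {π : S → A → ℝ | IsDetPolicy π}.Finite := by
  classical
  refine (Set.finite_range fun (f : S → A) s => (Pi.single (f s) (1 : ℝ) : A → ℝ)).subset ?_
  rintro π ⟨⟨h0, h1⟩, hdet⟩
  choose f hf using hdet
  refine ⟨f, funext fun s => funext fun a => ?_⟩
  by_cases ha : a = f s
  · subst ha
    simp [hf]
  · have hsum : ∑ b ∈ univ.erase (f s), π s b = 0 := by
      have := add_sum_erase univ (π s) (mem_univ (f s))
      rw [h1, hf] at this
      linarith
    have := (sum_eq_zero_iff_of_nonneg fun b _ => h0 s b).1 hsum a (by simp [ha])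
    simp [ha, this]

/-- A policy that randomizes at `s₀` splits, at that state, into the action `a` and the
conditional distribution on the other actions, both of smaller support. -/
lemma IsPolicy.exists_split {S A : Type*} [Fintype S] [Fintype A] {π : S → A → ℝ}
    (hπ : IsPolicy π) {s₀ : S} (hs₀ : ∀ a, π s₀ a ≠ 1) :
    ∃ (π₁ π₂ : S → A → ℝ) (p : ℝ), IsPolicy π₁ ∧ IsPolicy π₂ ∧ 0 < p ∧ p < 1 ∧
      (∀ s ≠ s₀, π₁ s = π s ∧ π₂ s = π s) ∧
      (∀ a, π s₀ a = p * π₁ s₀ a + (1 - p) * π₂ s₀ a) ∧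
      {x : S × A | π₁ x.1 x.2 ≠ 0}.ncard < {x : S × A | π x.1 x.2 ≠ 0}.ncard ∧
      {x : S × A | π₂ x.1 x.2 ≠ 0}.ncard < {x : S × A | π x.1 x.2 ≠ 0}.ncard := by
  classical
  obtain ⟨h0, h1⟩ := hπ
  obtain ⟨a, ha⟩ : ∃ a, π s₀ a ≠ 0 := by
    by_contra! h
    simpa [h] using h1 s₀
  have hsplit : π s₀ a + ∑ b ∈ univ.erase a, π s₀ b = 1 := by
    rw [add_sum_erase univ (π s₀) (mem_univ a), h1]
  have hp0 : 0 < π s₀ a := (h0 s₀ a).lt_of_ne' ha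
  have hp1 : π s₀ a < 1 := lt_of_le_of_ne
    (by linarith [sum_nonneg fun b (_ : b ∈ univ.erase a) => h0 s₀ b]) (hs₀ a)
  have hq : 0 < 1 - π s₀ a := sub_pos.2 hp1
  obtain ⟨b, hba, hb⟩ : ∃ b, b ≠ a ∧ π s₀ b ≠ 0 := by
    by_contra! h
    rw [sum_eq_zero fun b hb => h b (ne_of_mem_erase hb), add_zero] at hsplit
    exact hs₀ a hsplit
  refine ⟨Function.update π s₀ (Pi.single a 1),
    Function.update π s₀ fun c => if c = a then 0 else π s₀ c / (1 - π s₀ a), π s₀ a,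
    ⟨fun s c => ?_, fun s => ?_⟩, ⟨fun s c => ?_, fun s => ?_⟩, hp0, hp1, fun s hs => ?_,
    fun c => ?_, ?_, ?_⟩
  · by_cases hs : s = s₀
    · subst hs
      by_cases hc : c = a
      · simp [hc]
      · simp [hc]
    · simp [hs, h0]
  · by_cases hs : s = s₀
    · subst hs
      simp
    · simp [hs, h1]
  · by_cases hs : s = s₀
    · subst hs
      by_cases hc : c = a
      · simp [hc]
      · simpa [hc] using div_nonneg (h0 s c) hq.le
    · simp [hs, h0]
  · by_cases hs : s = s₀
    · subst hs
      rw [Function.update_self, ← add_sum_erase univ _ (mem_univ a), if_pos rfl, zero_add,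
        sum_congr rfl fun c hc => if_neg (ne_of_mem_erase hc), ← sum_div, div_eq_one_iff_eq hq.ne']
      linarith
    · simp [hs, h1]
  · simp [hs]
  · by_cases hc : c = a
    · simp [hc]
    · simp [hc, mul_div_cancel₀ _ hq.ne']
  · refine Set.ncard_lt_ncard ⟨?_, fun hsub => ?_⟩ (Set.toFinite _)
    · rintro ⟨s, c⟩ hx
      by_cases hs : s = s₀
      · subst hs
        by_cases hc : c = a
        · simpa [hc] using ha
        · simp [hc] at hx
      · simpa [hs] using hx
    · have : (s₀, b) ∈ _ := hsub hb
      simp [hba] at this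
  · refine Set.ncard_lt_ncard ⟨?_, fun hsub => ?_⟩ (Set.toFinite _)
    · rintro ⟨s, c⟩ hx
      by_cases hs : s = s₀
      · subst hs
        by_cases hc : c = a
        · simp [hc] at hx
        · intro h
          simp [hc, show π s c = 0 from h] at hx
      · simpa [hs] using hx
    · have : (s₀, a) ∈ _ := hsub ha
      simp at this

/-- A functional on policies that is affine along occupancy mixtures takes values in the convex
hull of its values at deterministic policies. -/
lemma IsPolicy.mem_convexHull_det {S A E : Type*} [Fintype S] [Fintype A] [AddCommGroup E]
    [Module ℝ E] (J : (S → A → ℝ) → E) (d : (S → A → ℝ) → S → ℝ)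
    (hd : ∀ π, IsPolicy π → ∀ s, 0 < d π s)
    (hmix : ∀ π₁ π₂ π, IsPolicy π₁ → IsPolicy π₂ → IsPolicy π → ∀ t u : ℝ, t + u = 1 →
      (∀ s a, (t * d π₁ s + u * d π₂ s) * π s a =
        t * (d π₁ s * π₁ s a) + u * (d π₂ s * π₂ s a)) → J π = t • J π₁ + u • J π₂)
    {π : S → A → ℝ} (hπ : IsPolicy π) : J π ∈ convexHull ℝ (J '' {π | IsDetPolicy π}) := by
  induction hn : {x : S × A | π x.1 x.2 ≠ 0}.ncard using Nat.strong_induction_on generalizing π with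
  | _ n ih =>
  subst hn
  by_cases hdet : ∀ s, ∃ a, π s a = 1
  · exact subset_convexHull ℝ _ ⟨π, ⟨hπ, hdet⟩, rfl⟩
  push Not at hdet
  obtain ⟨s₀, hs₀⟩ := hdet
  obtain ⟨π₁, π₂, p, hπ₁, hπ₂, hp0, hp1, hne, heq, hlt₁, hlt₂⟩ := hπ.exists_split hs₀
  have hd₁ := hd π₁ hπ₁ s₀
  have hd₂ := hd π₂ hπ₂ s₀
  have hq : 0 < 1 - p := sub_pos.2 hp1
  have hZ : 0 < p * d π₂ s₀ + (1 - p) * d π₁ s₀ := by positivity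
  have htu : p * d π₂ s₀ / (p * d π₂ s₀ + (1 - p) * d π₁ s₀) +
      (1 - p) * d π₁ s₀ / (p * d π₂ s₀ + (1 - p) * d π₁ s₀) = 1 := by
    rw [← add_div, div_self hZ.ne']
  rw [hmix π₁ π₂ π hπ₁ hπ₂ hπ _ _ htu fun s a => ?_]
  · exact convex_convexHull ℝ _ (ih _ hlt₁ hπ₁ rfl) (ih _ hlt₂ hπ₂ rfl) (by positivity)
      (by positivity) htu
  · by_cases hs : s = s₀
    · subst hs
      rw [heq a]
      field_simp
      ring
    · rw [(hne s hs).1, (hne s hs).2]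
      ring

/-- For a finite discounted MO-MDP with initial distribution `μ` positive on every state,
the set of long-term returns `J(μ)` equals the convex hull of the finite set of returns of
deterministic stationary policies; in particular it is a compact convex polytope and every
extreme point of `J(μ)` is the return of a deterministic stationary policy. -/
theorem returns_set_eq_convexHull_det
    {S A : Type*} [Fintype S] [Fintype A] [Nonempty S] [Nonempty A]
    {D : ℕ} (hD : 1 ≤ D)
    (P : S → A → S → ℝ)
    (hP0 : ∀ s a s', 0 ≤ P s a s') (hP1 : ∀ s a, ∑ s', P s a s' = 1)
    (r : S → A → Fin D → ℝ)
    (γ : ℝ) (hγ0 : 0 ≤ γ) (hγ1 : γ < 1)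
    (μ : S → ℝ) (hμpos : ∀ s, 0 < μ s) (hμ1 : ∑ s, μ s = 1)
    (V : (S → A → ℝ) → S → Fin D → ℝ)
    (hV : ∀ π : S → A → ℝ, IsPolicy π → ∀ s,
      V π s = (∑ a, π s a • r s a) + γ • ∑ s', (∑ a, π s a * P s a s') • V π s')
    (J : (S → A → ℝ) → Fin D → ℝ) (hJ : ∀ π, J π = ∑ s, μ s • V π s)
    (Jset DJ : Set (Fin D → ℝ))
    (hJset : Jset = {x | ∃ π, IsPolicy π ∧ x = J π})
    (hDJ : DJ = {x | ∃ π, IsDetPolicy π ∧ x = J π}) :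
    DJ.Finite ∧ Jset = convexHull ℝ DJ ∧ IsCompact Jset ∧ Convex ℝ Jset ∧
      Jset.extremePoints ℝ ⊆ DJ := by
  classical
  have hocc : ∀ π : S → A → ℝ, ∃ d : S → ℝ,
      IsPolicy π → (∀ s, 0 < d s) ∧ IsOccupancy P γ μ π d := fun π => by
    by_cases hπ : IsPolicy π
    · obtain ⟨d, hd⟩ := exists_isOccupancy P hP0 hP1 γ hγ0 hγ1 μ hμpos π hπ
      exact ⟨d, fun _ => hd⟩
    · exact ⟨0, fun h => absurd h hπ⟩
  choose d hd using hocc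
  have hJd : ∀ π, IsPolicy π → ∀ e, IsOccupancy P γ μ π e →
      J π = ∑ s, ∑ a, (e s * π s a) • r s a := fun π hπ e he => by
    rw [hJ, he.sum_smul_value_eq r (V π) (hV π hπ)]
  have hmix : ∀ π₁ π₂ π, IsPolicy π₁ → IsPolicy π₂ → IsPolicy π → ∀ t u : ℝ, t + u = 1 →
      (∀ s a, (t * d π₁ s + u * d π₂ s) * π s a =
        t * (d π₁ s * π₁ s a) + u * (d π₂ s * π₂ s a)) → J π = t • J π₁ + u • J π₂ := by
    intro π₁ π₂ π h₁ h₂ hπ t u htu h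
    rw [hJd π hπ _ ((hd π₁ h₁).2.mix (hd π₂ h₂).2 htu h), hJd π₁ h₁ _ (hd π₁ h₁).2,
      hJd π₂ h₂ _ (hd π₂ h₂).2]
    simp only [smul_sum, smul_smul, ← sum_add_distrib, ← add_smul, h]
  have hDJ' : DJ = J '' {π | IsDetPolicy π} := by
    rw [hDJ]
    ext x
    simp [eq_comm]
  have hfin : DJ.Finite := hDJ' ▸ (finite_setOf_isDetPolicy S A).image J
  have hconv : Convex ℝ Jset := by
    rw [hJset]
    rintro _ ⟨π₁, h₁, rfl⟩ _ ⟨π₂, h₂, rfl⟩ t u ht hu htu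
    have hpos : ∀ s, 0 < t * d π₁ s + u * d π₂ s := fun s =>
      convex_Ioi (0 : ℝ) ((hd π₁ h₁).1 s) ((hd π₂ h₂).1 s) ht hu htu
    have hπ : IsPolicy fun s a =>
        (t * (d π₁ s * π₁ s a) + u * (d π₂ s * π₂ s a)) / (t * d π₁ s + u * d π₂ s) := by
      refine ⟨fun s a => div_nonneg (add_nonneg ?_ ?_) (hpos s).le, fun s => ?_⟩
      · exact mul_nonneg ht (mul_nonneg ((hd π₁ h₁).1 s).le (h₁.1 s a))
      · exact mul_nonneg hu (mul_nonneg ((hd π₂ h₂).1 s).le (h₂.1 s a))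
      · rw [← sum_div, sum_add_distrib]
        simp only [← mul_sum, h₁.2, h₂.2, mul_one]
        exact div_self (hpos s).ne'
    exact ⟨_, hπ, (hmix π₁ π₂ _ h₁ h₂ hπ t u htu fun s a => mul_div_cancel₀ _ (hpos s).ne').symm⟩
  have heq : Jset = convexHull ℝ DJ := by
    refine Set.Subset.antisymm ?_ (convexHull_min ?_ hconv)
    · rw [hJset, hDJ']
      rintro _ ⟨π, hπ, rfl⟩
      exact hπ.mem_convexHull_det J d (fun π h => (hd π h).1) hmix
    · rw [hJset, hDJ]
      rintro x ⟨π, hπ, hx⟩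
      exact ⟨π, hπ.1, hx⟩
  refine ⟨hfin, heq, ?_, hconv, ?_⟩
  · rw [heq]
    exact hfin.isCompact_convexHull ℝ
  · rw [heq]
    exact extremePoints_convexHull_subset
end

section
/- Let V ⊆ ℝ^D be a nonempty finite set, C = convexHull(V), and x ∈ C. Then x is Pareto optimal in C if and only if there exists a vector w ∈ ℝ^D with every coordinate strictly positive such that wᵀx ≥ wᵀy for all y ∈ C. -/
open Finset

/-- `u` strictly dominates `v` if `u ≥ v` componentwise and `u ≠ v`. -/
def StrictlyDominates {D : ℕ} (u v : Fin D → ℝ) : Prop :=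
  (∀ i, v i ≤ u i) ∧ u ≠ v

/-- A point `x` is Pareto optimal in `T` if no element of `T` strictly dominates it. -/
def ParetoOptimalIn {D : ℕ} (x : Fin D → ℝ) (T : Set (Fin D → ℝ)) : Prop :=
  ∀ y ∈ T, ¬ StrictlyDominates y x

/-- **Farkas' lemma** for a finite family of vectors: a vector on which every functional that is
nonnegative on the family is nonnegative lies in the cone generated by the family. -/
theorem exists_nonneg_sum_smul_eq_of_forall_dual {𝕜 E ι : Type*} [Field 𝕜] [LinearOrder 𝕜]
    [IsStrictOrderedRing 𝕜] [AddCommGroup E] [Module 𝕜 E] (t : Finset ι) (s : ι → E) (y : E)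
    (h : ∀ f : E →ₗ[𝕜] 𝕜, (∀ i ∈ t, 0 ≤ f (s i)) → 0 ≤ f y) :
    ∃ c : ι → 𝕜, (∀ i, 0 ≤ c i) ∧ ∑ i ∈ t, c i • s i = y := by
  classical
  induction t using Finset.induction_on generalizing s y with
  | empty =>
    refine ⟨0, fun _ => le_rfl, ?_⟩
    rw [Finset.sum_empty, eq_comm, ← Module.forall_dual_apply_eq_zero_iff 𝕜]
    intro f
    have h₁ := h f (by simp)
    have h₂ := h (-f) (by simp)
    rw [LinearMap.neg_apply] at h₂
    linarith
  | insert a t ha ih =>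
    by_cases hy : ∀ f : E →ₗ[𝕜] 𝕜, (∀ i ∈ t, 0 ≤ f (s i)) → 0 ≤ f y
    · obtain ⟨c, hc, hcy⟩ := ih s y hy
      refine ⟨Function.update c a 0, fun i => ?_, ?_⟩
      · obtain rfl | hi := eq_or_ne i a
        · simp
        · simpa [hi] using hc i
      · rw [Finset.sum_insert ha, ← hcy, Function.update_self, zero_smul, zero_add]
        refine Finset.sum_congr rfl fun i hi => ?_
        rw [Function.update_of_ne (ne_of_mem_of_not_mem hi ha)]
    · push Not at hy
      obtain ⟨f, hf, hfy⟩ := hy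
      have hfa : f (s a) < 0 := by
        by_contra! hfa
        exact hfy.not_ge (h f (by simpa [hfa] using hf))
      -- the projection onto the kernel of `f` along `s a`
      let P : E →ₗ[𝕜] E := LinearMap.id - (f.smulRight ((f (s a))⁻¹ • s a))
      have hP (u : E) : P u = u - (f u * (f (s a))⁻¹) • s a := by
        simp [P, smul_smul]
      have hPa : P (s a) = 0 := by
        rw [hP, mul_inv_cancel₀ hfa.ne, one_smul, sub_self]
      obtain ⟨c, hc, hcy⟩ := ih (fun i => P (s i)) (P y) fun g hg => by
        refine h (g ∘ₗ P) fun i hi => ?_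
        obtain rfl | hi := Finset.mem_insert.1 hi
        · simp [hPa]
        · exact hg i hi
      have hinv : (f (s a))⁻¹ ≤ 0 := (inv_lt_zero.2 hfa).le
      let r : 𝕜 := f y * (f (s a))⁻¹ - ∑ i ∈ t, c i * (f (s i) * (f (s a))⁻¹)
      have hr : 0 ≤ r :=
        sub_nonneg.2 <| (Finset.sum_nonpos fun i hi => mul_nonpos_of_nonneg_of_nonpos (hc i)
          (mul_nonpos_of_nonneg_of_nonpos (hf i hi) hinv)).trans
          (mul_nonneg_of_nonpos_of_nonpos hfy.le hinv)
      refine ⟨Function.update c a r, fun i => ?_, ?_⟩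
      · obtain rfl | hi := eq_or_ne i a
        · simpa using hr
        · simpa [hi] using hc i
      · have hsum : ∑ i ∈ t, Function.update c a r i • s i = ∑ i ∈ t, c i • s i :=
          Finset.sum_congr rfl fun i hi => by
            rw [Function.update_of_ne (ne_of_mem_of_not_mem hi ha)]
        rw [Finset.sum_insert ha, Function.update_self, hsum]
        simp only [hP, smul_sub, Finset.sum_sub_distrib, smul_smul, ← Finset.sum_smul] at hcy
        rw [sub_eq_sub_iff_add_eq_add] at hcy
        rw [sub_smul, sub_add_eq_add_sub, sub_eq_iff_eq_add, add_comm, hcy]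

/-- If `x` is Pareto optimal in the convex hull of `V`, no nonnegative combination of the
directions `v - x` is a nonzero vector with nonnegative coordinates. -/
theorem ParetoOptimalIn.sum_smul_sub_eq_zero {D : ℕ} {T : Finset (Fin D → ℝ)} {x : Fin D → ℝ}
    (hx : ParetoOptimalIn x (convexHull ℝ (T : Set (Fin D → ℝ)))) {c : T → ℝ}
    (hc : ∀ v, 0 ≤ c v) (h : 0 ≤ ∑ v, c v • ((v : Fin D → ℝ) - x)) :
    ∑ v, c v • ((v : Fin D → ℝ) - x) = 0 := by
  obtain h₀ | hpos := (Finset.sum_nonneg fun v (_ : v ∈ Finset.univ) => hc v).eq_or_lt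
  · rw [eq_comm, Finset.sum_eq_zero_iff_of_nonneg fun v _ => hc v] at h₀
    exact Finset.sum_eq_zero fun v hv => by rw [h₀ v hv, zero_smul]
  · by_contra hne
    have hmem := Finset.univ.centerMass_mem_convexHull (R := ℝ) (s := (T : Set (Fin D → ℝ)))
      (z := fun v : T => (v : Fin D → ℝ)) (fun v _ => hc v) hpos fun v _ => v.2
    have heq : Finset.univ.centerMass c (fun v : T => (v : Fin D → ℝ)) =
        x + (∑ v, c v)⁻¹ • ∑ v, c v • ((v : Fin D → ℝ) - x) := by
      rw [Finset.centerMass]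
      simp only [smul_sub, Finset.sum_sub_distrib, ← Finset.sum_smul]
      rw [inv_smul_smul₀ hpos.ne', add_sub_cancel]
    refine hx _ hmem ⟨?_, ?_⟩
    · rw [heq]
      exact le_add_of_nonneg_right (smul_nonneg (inv_nonneg.2 hpos.le) h)
    · rw [heq, Ne, add_eq_left]
      exact smul_ne_zero (inv_ne_zero hpos.ne') hne

/-- At a Pareto optimal point, every coordinate admits a nonnegative supporting functional that
is positive on that coordinate. -/
theorem ParetoOptimalIn.exists_dual {D : ℕ} {T : Finset (Fin D → ℝ)} {x : Fin D → ℝ}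
    (hx : ParetoOptimalIn x (convexHull ℝ (T : Set (Fin D → ℝ)))) (i : Fin D) :
    ∃ f : (Fin D → ℝ) →ₗ[ℝ] ℝ, (∀ v ∈ T, f v ≤ f x) ∧ (∀ j, 0 ≤ f (Pi.single j 1)) ∧
      0 < f (Pi.single i 1) := by
  by_contra! hcon
  obtain ⟨c, hc, hcy⟩ := exists_nonneg_sum_smul_eq_of_forall_dual (𝕜 := ℝ) Finset.univ
    (Sum.elim (fun v : T => x - (v : Fin D → ℝ)) fun j : Fin D => Pi.single j 1)
    (-Pi.single i 1) fun f hf => by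
      rw [map_neg, neg_nonneg]
      refine hcon f (fun v hv => ?_) fun j => hf (.inr j) (Finset.mem_univ _)
      simpa using hf (.inl ⟨v, hv⟩) (Finset.mem_univ _)
  simp only [Fintype.sum_sum_type, Sum.elim_inl, Sum.elim_inr] at hcy
  have hnonneg : 0 ≤ ∑ j, c (.inr j) • (Pi.single j 1 : Fin D → ℝ) :=
    Finset.sum_nonneg fun j _ => smul_nonneg (hc _) (Pi.single_nonneg.2 zero_le_one)
  have hsum : ∑ v : T, c (.inl v) • ((v : Fin D → ℝ) - x) =
      Pi.single i 1 + ∑ j, c (.inr j) • (Pi.single j 1 : Fin D → ℝ) := by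
    have : ∑ v : T, c (.inl v) • ((v : Fin D → ℝ) - x) =
        -∑ v : T, c (.inl v) • (x - (v : Fin D → ℝ)) := by
      simp only [← Finset.sum_neg_distrib, ← smul_neg, neg_sub]
    rw [this, eq_sub_of_add_eq hcy]
    abel
  have hzero := hx.sum_smul_sub_eq_zero (fun v => hc (.inl v))
    (hsum ▸ add_nonneg (Pi.single_nonneg.2 zero_le_one) hnonneg)
  have hi := congrFun (hsum.symm.trans hzero) i
  have := hnonneg i
  rw [Pi.add_apply, Pi.single_eq_same] at hi
  simp only [Pi.zero_apply] at hi this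
  linarith

/-- A point of a convex polytope is Pareto optimal iff it maximizes a strictly positive
linear functional over the polytope. -/
theorem paretoOptimal_iff_pos_weight
    {D : ℕ} (V : Set (Fin D → ℝ)) (hfin : V.Finite) (hne : V.Nonempty)
    (x : Fin D → ℝ) (hx : x ∈ convexHull ℝ V) :
    ParetoOptimalIn x (convexHull ℝ V) ↔
      ∃ w : Fin D → ℝ, (∀ i, 0 < w i) ∧
        ∀ y ∈ convexHull ℝ V, ∑ i, w i * y i ≤ ∑ i, w i * x i := by
  constructor
  · intro hopt
    lift V to Finset (Fin D → ℝ) using hfin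
    choose f hfV hf hfpos using hopt.exists_dual
    let g : (Fin D → ℝ) →ₗ[ℝ] ℝ := ∑ i, f i
    have hg (y : Fin D → ℝ) : ∑ i, g (Pi.single i 1) * y i = g y := by
      conv_rhs => rw [pi_eq_sum_univ' y, map_sum]
      refine Finset.sum_congr rfl fun i _ => ?_
      rw [map_smul, smul_eq_mul, mul_comm]
    refine ⟨fun i => g (Pi.single i 1), fun i => ?_, fun y hy => ?_⟩
    · simp only [g, LinearMap.sum_apply]
      exact Finset.sum_pos' (fun j _ => hf j i) ⟨i, Finset.mem_univ i, hfpos i⟩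
    · rw [hg, hg]
      refine convexHull_min (t := {y | g y ≤ g x}) (fun v hv => ?_)
        (convex_halfSpace_le g.isLinear _) hy
      simp only [g, Set.mem_ofPred_eq, LinearMap.sum_apply]
      exact Finset.sum_le_sum fun i _ => hfV i v hv
  · rintro ⟨w, hw, hmax⟩ y hy ⟨hle, hne'⟩
    obtain ⟨i, hi⟩ := Function.ne_iff.1 hne'
    refine (hmax y hy).not_gt (Finset.sum_lt_sum (fun j _ => ?_) ⟨i, Finset.mem_univ i, ?_⟩)
    · exact mul_le_mul_of_nonneg_left (hle j) (hw j).le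
    · exact mul_lt_mul_of_pos_left ((hle i).lt_of_ne' hi) (hw i)
end

section
/- Consider a finite discounted MO-MDP with initial distribution μ satisfying μ(s) > 0 for every state s. Let π₁ and π₂ be deterministic stationary policies, and suppose the segment [J^{π₁}(μ), J^{π₂}(μ)] is a face of J(μ), i.e., there exist w ∈ ℝ^D and c ∈ ℝ with wᵀy ≤ c for all y ∈ J(μ) and J(μ) ∩ {x : wᵀx = c} = {α J^{π₁}(μ) + (1−α) J^{π₂}(μ) : α ∈ [0,1]}. Then every point of this edge is the return of a convex combination of π₁ and π₂: for every α ∈ [0,1] there exists β ∈ [0,1] such that α J^{π₁}(μ) + (1−α) J^{π₂}(μ) = J^{β π₁ + (1−β) π₂}(μ), where (β π₁ + (1−β) π₂)(s,a) = β π₁(s,a) + (1−β) π₂(s,a). -/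
open Finset

/-- The scalar state-action value obtained by one-step lookahead from the state values `x`. -/
def lookahead {S A : Type*} [Fintype S] (P : S → A → S → ℝ) (r : S → A → ℝ) (γ : ℝ)
    (x : S → ℝ) (s : S) (a : A) : ℝ :=
  r s a + γ * ∑ s', P s a s' * x s'

/-- The policy playing `π₁` with probability `β` and `π₂` with probability `1 - β`. -/
def mixPolicy {S A : Type*} (π₁ π₂ : S → A → ℝ) (β : ℝ) : S → A → ℝ :=
  fun s a => β * π₁ s a + (1 - β) * π₂ s a

section Scalar

variable {S A : Type*} [Fintype A]

theorem IsPolicy.mixPolicy {π₁ π₂ : S → A → ℝ} (h₁ : IsPolicy π₁) (h₂ : IsPolicy π₂)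
    {β : ℝ} (hβ : β ∈ Set.Icc (0 : ℝ) 1) : IsPolicy (mixPolicy π₁ π₂ β) := by
  refine ⟨fun s a => ?_, fun s => ?_⟩
  · exact add_nonneg (mul_nonneg hβ.1 (h₁.1 s a)) (mul_nonneg (sub_nonneg.2 hβ.2) (h₂.1 s a))
  · simp only [_root_.mixPolicy, sum_add_distrib, ← mul_sum, h₁.2 s, h₂.2 s]
    ring

theorem sum_mixPolicy_mul (π₁ π₂ : S → A → ℝ) (β : ℝ) (s : S) (f : A → ℝ) :
    ∑ a, mixPolicy π₁ π₂ β s a * f a =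
      β * ∑ a, π₁ s a * f a + (1 - β) * ∑ a, π₂ s a * f a := by
  simp only [mixPolicy, mul_sum, ← sum_add_distrib]
  exact sum_congr rfl fun a _ => by ring

variable [Fintype S] {P : S → A → S → ℝ} {r : S → A → ℝ} {γ : ℝ}

/-- Approximate comparison principle for policy evaluation. -/
theorem sub_le_div_of_sub_le_lookahead
    (hP0 : ∀ s a s', 0 ≤ P s a s') (hP1 : ∀ s a, ∑ s', P s a s' = 1)
    (hγ0 : 0 ≤ γ) (hγ1 : γ < 1) {π : S → A → ℝ} (hπ : IsPolicy π) {x y : S → ℝ} {e : ℝ}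
    (h : ∀ s, x s - y s ≤
      ∑ a, π s a * lookahead P r γ x s a - ∑ a, π s a * lookahead P r γ y s a + e) (s : S) :
    x s - y s ≤ e / (1 - γ) := by
  have : Nonempty S := ⟨s⟩
  obtain ⟨t, ht⟩ := Finite.exists_max fun s => x s - y s
  have key : ∑ a, π t a * lookahead P r γ x t a - ∑ a, π t a * lookahead P r γ y t a ≤
      γ * (x t - y t) := by
    calc ∑ a, π t a * lookahead P r γ x t a - ∑ a, π t a * lookahead P r γ y t a
        = ∑ a, π t a * (γ * ∑ s', P t a s' * (x s' - y s')) := by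
          rw [← sum_sub_distrib]
          refine sum_congr rfl fun a _ => ?_
          simp only [lookahead, mul_sub, sum_sub_distrib]
          ring
      _ ≤ ∑ a, π t a * (γ * ∑ s', P t a s' * (x t - y t)) := by
          refine sum_le_sum fun a _ => mul_le_mul_of_nonneg_left ?_ (hπ.1 t a)
          refine mul_le_mul_of_nonneg_left (sum_le_sum fun s' _ => ?_) hγ0
          exact mul_le_mul_of_nonneg_left (ht s') (hP0 t a s')
      _ = γ * (x t - y t) := by
          simp only [← sum_mul, hP1, one_mul, hπ.2]
  have := h t
  refine (ht s).trans ?_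
  rw [le_div_iff₀ (sub_pos.2 hγ1)]
  linarith

/-- A value vector dominated by its one-step improvement is dominated by the policy's value. -/
theorem le_of_le_lookahead
    (hP0 : ∀ s a s', 0 ≤ P s a s') (hP1 : ∀ s a, ∑ s', P s a s' = 1)
    (hγ0 : 0 ≤ γ) (hγ1 : γ < 1) {π : S → A → ℝ} (hπ : IsPolicy π) {x y : S → ℝ}
    (hx : ∀ s, x s ≤ ∑ a, π s a * lookahead P r γ x s a)
    (hy : ∀ s, ∑ a, π s a * lookahead P r γ y s a ≤ y s) (s : S) : x s ≤ y s := by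
  have := sub_le_div_of_sub_le_lookahead (e := 0) (r := r) hP0 hP1 hγ0 hγ1 hπ (x := x) (y := y)
    (fun s => by linarith [hx s, hy s]) s
  rw [zero_div] at this
  linarith

/-- The value of a mixture of two policies depends continuously on the mixing weight. -/
theorem continuousOn_mixPolicy_value
    (hP0 : ∀ s a s', 0 ≤ P s a s') (hP1 : ∀ s a, ∑ s', P s a s' = 1)
    (hγ0 : 0 ≤ γ) (hγ1 : γ < 1) {π₁ π₂ : S → A → ℝ} (h₁ : IsPolicy π₁) (h₂ : IsPolicy π₂)
    {v : ℝ → S → ℝ}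
    (hv : ∀ β ∈ Set.Icc (0 : ℝ) 1, ∀ s,
      v β s = ∑ a, mixPolicy π₁ π₂ β s a * lookahead P r γ (v β) s a) (s : S) :
    ContinuousOn (fun β => v β s) (Set.Icc 0 1) := by
  intro b hb
  set g : S → ℝ := fun s =>
    ∑ a, π₁ s a * lookahead P r γ (v b) s a - ∑ a, π₂ s a * lookahead P r γ (v b) s a with hg
  set M : ℝ := ∑ s, |g s| with hM
  have hgM : ∀ β s, |(β - b) * g s| ≤ |β - b| * M := fun β s => by
    rw [abs_mul]
    gcongr
    exact single_le_sum (f := fun s => |g s|) (fun _ _ => abs_nonneg _) (mem_univ s)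
  have hbound : ∀ β ∈ Set.Icc (0 : ℝ) 1, |v β s - v b s| ≤ |β - b| * M / (1 - γ) := by
    intro β hβ
    have hstep : ∀ s, ∑ a, mixPolicy π₁ π₂ β s a * lookahead P r γ (v b) s a =
        v b s + (β - b) * g s := fun s => by
      rw [hv b hb s, sum_mixPolicy_mul, sum_mixPolicy_mul, hg]
      ring
    have hmix := h₁.mixPolicy h₂ hβ
    rw [abs_sub_le_iff]
    constructor
    · refine sub_le_div_of_sub_le_lookahead (r := r) hP0 hP1 hγ0 hγ1 hmix (fun s => ?_) s
      rw [← hv β hβ s, hstep]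
      linarith [le_abs_self ((β - b) * g s), hgM β s]
    · refine sub_le_div_of_sub_le_lookahead (r := r) hP0 hP1 hγ0 hγ1 hmix (fun s => ?_) s
      rw [← hv β hβ s, hstep]
      linarith [neg_abs_le ((β - b) * g s), hgM β s]
  rw [ContinuousWithinAt, tendsto_iff_dist_tendsto_zero]
  refine squeeze_zero' (Filter.Eventually.of_forall fun _ => dist_nonneg)
    (Filter.eventually_of_mem self_mem_nhdsWithin hbound) ?_
  have hc : Continuous fun β : ℝ => |β - b| * M / (1 - γ) := by fun_prop
  simpa using (hc.tendsto b).mono_left nhdsWithin_le_nhds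

/-- Two policies maximizing the expected return under a positive initial distribution have the
same value at every state. -/
theorem value_eq_of_isMax
    (hP0 : ∀ s a s', 0 ≤ P s a s') (hP1 : ∀ s a, ∑ s', P s a s' = 1)
    (hγ0 : 0 ≤ γ) (hγ1 : γ < 1) {μ : S → ℝ} (hμ : ∀ s, 0 < μ s) {v : (S → A → ℝ) → S → ℝ}
    (hv : ∀ π, IsPolicy π → ∀ s, v π s = ∑ a, π s a * lookahead P r γ (v π) s a)
    {c : ℝ} (hc : ∀ π, IsPolicy π → ∑ s, μ s * v π s ≤ c)
    {π₁ π₂ : S → A → ℝ} (h₁ : IsPolicy π₁) (h₂ : IsPolicy π₂)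
    (e₁ : ∑ s, μ s * v π₁ s = c) (e₂ : ∑ s, μ s * v π₂ s = c) : v π₁ = v π₂ := by
  classical
  set u : S → ℝ := fun s => max (v π₁ s) (v π₂ s) with hu
  set π : S → A → ℝ := fun s => if v π₂ s ≤ v π₁ s then π₁ s else π₂ s with hπdef
  have hπ : IsPolicy π := by
    refine ⟨fun s a => ?_, fun s => ?_⟩ <;> simp only [hπdef] <;> split_ifs
    exacts [h₁.1 s a, h₂.1 s a, h₁.2 s, h₂.2 s]
  have hmono : ∀ {x : S → ℝ} {ρ : S → A → ℝ}, IsPolicy ρ → (∀ s, x s ≤ u s) → ∀ s,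
      ∑ a, ρ s a * lookahead P r γ x s a ≤ ∑ a, ρ s a * lookahead P r γ u s a := by
    intro x ρ hρ hx s
    unfold lookahead
    gcongr with a _ s' _
    · exact hρ.1 s a
    · exact hP0 s a s'
    · exact hx s'
  have hle : ∀ s, u s ≤ v π s := by
    refine le_of_le_lookahead hP0 hP1 hγ0 hγ1 hπ (fun s => ?_) (fun s => (hv π hπ s).ge)
    by_cases h : v π₂ s ≤ v π₁ s
    · have := hmono h₁ (fun s => le_max_left (v π₁ s) (v π₂ s)) s
      rw [← hv π₁ h₁ s] at this
      simpa [hπdef, h, hu] using this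
    · have := hmono h₂ (fun s => le_max_right (v π₁ s) (v π₂ s)) s
      rw [← hv π₂ h₂ s] at this
      simpa [hπdef, h, hu, (not_le.1 h).le] using this
  have huc : ∑ s, μ s * u s ≤ c :=
    (sum_le_sum fun s _ => mul_le_mul_of_nonneg_left (hle s) (hμ s).le).trans (hc π hπ)
  have heq : ∀ {x : S → ℝ}, (∀ s, x s ≤ u s) → ∑ s, μ s * x s = c → x = u := by
    intro x hx e
    have hterm : ∀ s ∈ univ, μ s * x s ≤ μ s * u s :=
      fun s _ => mul_le_mul_of_nonneg_left (hx s) (hμ s).le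
    have := (sum_eq_sum_iff_of_le hterm).1 (le_antisymm (sum_le_sum hterm) (huc.trans e.ge))
    exact funext fun s => mul_left_cancel₀ (hμ s).ne' (this s (mem_univ s))
  exact (heq (fun s => le_max_left _ _) e₁).trans (heq (fun s => le_max_right _ _) e₂).symm

/-- Mixing two policies with a common value preserves that value. -/
theorem mixPolicy_value_eq
    (hP0 : ∀ s a s', 0 ≤ P s a s') (hP1 : ∀ s a, ∑ s', P s a s' = 1)
    (hγ0 : 0 ≤ γ) (hγ1 : γ < 1) {v : (S → A → ℝ) → S → ℝ}
    (hv : ∀ π, IsPolicy π → ∀ s, v π s = ∑ a, π s a * lookahead P r γ (v π) s a)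
    {π₁ π₂ : S → A → ℝ} (h₁ : IsPolicy π₁) (h₂ : IsPolicy π₂) (h : v π₁ = v π₂)
    {β : ℝ} (hβ : β ∈ Set.Icc (0 : ℝ) 1) : v (mixPolicy π₁ π₂ β) = v π₁ := by
  have hmix := h₁.mixPolicy h₂ hβ
  have hfix : ∀ s, ∑ a, mixPolicy π₁ π₂ β s a * lookahead P r γ (v π₁) s a = v π₁ s := by
    intro s
    have e₂ := hv π₂ h₂ s
    rw [← h] at e₂
    rw [sum_mixPolicy_mul, ← hv π₁ h₁ s, ← e₂]
    ring
  funext s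
  exact le_antisymm
    (le_of_le_lookahead hP0 hP1 hγ0 hγ1 hmix (fun s => (hv _ hmix s).le) (fun s => (hfix s).le) s)
    (le_of_le_lookahead hP0 hP1 hγ0 hγ1 hmix (fun s => (hfix s).ge) (fun s => (hv _ hmix s).ge) s)

end Scalar



/-- If the segment between the returns of two deterministic policies `π₁, π₂` is a face of
`J(μ)`, then every point of this edge is the return of a convex combination of `π₁` and `π₂`. -/
theorem edge_achieved_by_mixtures
    {S A : Type*} [Fintype S] [Fintype A] [Nonempty S] [Nonempty A]
    {D : ℕ} (hD : 1 ≤ D)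
    (P : S → A → S → ℝ)
    (hP0 : ∀ s a s', 0 ≤ P s a s') (hP1 : ∀ s a, ∑ s', P s a s' = 1)
    (r : S → A → Fin D → ℝ)
    (γ : ℝ) (hγ0 : 0 ≤ γ) (hγ1 : γ < 1)
    (μ : S → ℝ) (hμpos : ∀ s, 0 < μ s) (hμ1 : ∑ s, μ s = 1)
    (V : (S → A → ℝ) → S → Fin D → ℝ)
    (hV : ∀ π : S → A → ℝ, IsPolicy π → ∀ s,
      V π s = (∑ a, π s a • r s a) + γ • ∑ s', (∑ a, π s a * P s a s') • V π s')
    (J : (S → A → ℝ) → Fin D → ℝ) (hJ : ∀ π, J π = ∑ s, μ s • V π s)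
    (Jset : Set (Fin D → ℝ))
    (hJset : Jset = {x | ∃ π, IsPolicy π ∧ x = J π})
    (π₁ π₂ : S → A → ℝ) (h₁ : IsDetPolicy π₁) (h₂ : IsDetPolicy π₂)
    (w : Fin D → ℝ) (c : ℝ)
    (hface1 : ∀ y ∈ Jset, ∑ i, w i * y i ≤ c)
    (hface2 : Jset ∩ {x | ∑ i, w i * x i = c} =
      {x | ∃ α ∈ Set.Icc (0 : ℝ) 1, x = α • J π₁ + (1 - α) • J π₂}) :
    ∀ α ∈ Set.Icc (0 : ℝ) 1, ∃ β ∈ Set.Icc (0 : ℝ) 1,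
      α • J π₁ + (1 - α) • J π₂ =
        J (fun s a => β * π₁ s a + (1 - β) * π₂ s a) := by
  have hscal : ∀ (z : Fin D → ℝ) (π : S → A → ℝ), IsPolicy π → ∀ s,
      ∑ i, z i * V π s i = ∑ a, π s a *
        lookahead P (fun s a => ∑ i, z i * r s a i) γ (fun s => ∑ i, z i * V π s i) s a := by
    intro z π hπ s
    have hcoord : ∀ i, V π s i = ∑ a, π s a * (r s a i + γ * ∑ s', P s a s' * V π s' i) := by
      intro i
      have h := congrFun (hV π hπ s) i
      simp only [Pi.add_apply, Finset.sum_apply, Pi.smul_apply, smul_eq_mul] at h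
      rw [h]
      simp only [mul_add, sum_add_distrib, mul_sum, sum_mul]
      congr 1
      rw [sum_comm]
      exact sum_congr rfl fun a _ => sum_congr rfl fun s' _ => by ring
    have hlook : ∀ a, lookahead P (fun s a => ∑ i, z i * r s a i) γ
        (fun s => ∑ i, z i * V π s i) s a =
        ∑ i, z i * (r s a i + γ * ∑ s', P s a s' * V π s' i) := by
      intro a
      simp only [lookahead, mul_add, sum_add_distrib, mul_sum]
      congr 1
      rw [sum_comm]
      exact sum_congr rfl fun i _ => sum_congr rfl fun s' _ => by ring
    simp only [hlook]
    simp only [mul_sum (ι := Fin D)]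
    rw [sum_comm]
    refine sum_congr rfl fun i _ => ?_
    rw [hcoord i, mul_sum]
    exact sum_congr rfl fun a _ => by ring
  have hJi : ∀ π i, J π i = ∑ s, μ s * V π s i := by
    intro π i
    simp [hJ, Finset.sum_apply]
  have hJw : ∀ π, ∑ i, w i * J π i = ∑ s, μ s * ∑ i, w i * V π s i := by
    intro π
    simp only [hJi, mul_sum]
    rw [sum_comm]
    exact sum_congr rfl fun s _ => sum_congr rfl fun i _ => by ring
  have hmem : ∀ {α : ℝ}, α ∈ Set.Icc (0 : ℝ) 1 →
      ∑ i, w i * (α • J π₁ + (1 - α) • J π₂) i = c := by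
    intro α hα
    have h : α • J π₁ + (1 - α) • J π₂ ∈ Jset ∩ {x | ∑ i, w i * x i = c} := by
      rw [hface2]
      exact ⟨α, hα, rfl⟩
    exact h.2
  have e₁ : ∑ i, w i * J π₁ i = c := by simpa using hmem (α := 1) (by simp)
  have e₂ : ∑ i, w i * J π₂ i = c := by simpa using hmem (α := 0) (by simp)
  have hveq := value_eq_of_isMax (v := fun π s => ∑ i, w i * V π s i) hP0 hP1 hγ0 hγ1 hμpos
    (hscal w) (c := c)
    (fun π hπ => (hJw π).ge.trans (hface1 _ (by rw [hJset]; exact ⟨π, hπ, rfl⟩)))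
    h₁.1 h₂.1 ((hJw π₁).symm.trans e₁) ((hJw π₂).symm.trans e₂)
  have hseg : ∀ β ∈ Set.Icc (0 : ℝ) 1, ∃ α ∈ Set.Icc (0 : ℝ) 1,
      J (mixPolicy π₁ π₂ β) = α • J π₁ + (1 - α) • J π₂ := by
    intro β hβ
    have hval := mixPolicy_value_eq (v := fun π s => ∑ i, w i * V π s i) hP0 hP1 hγ0 hγ1
      (hscal w) h₁.1 h₂.1 hveq hβ
    have h : J (mixPolicy π₁ π₂ β) ∈ Jset ∩ {x | ∑ i, w i * x i = c} := by
      refine ⟨by rw [hJset]; exact ⟨_, h₁.1.mixPolicy h₂.1 hβ, rfl⟩, ?_⟩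
      rw [Set.mem_ofPred_eq, hJw, ← e₁, hJw]
      exact sum_congr rfl fun s _ => congrArg (μ s * ·) (congrFun hval s)
    rw [hface2] at h
    exact h
  have hcont : ∀ i, ContinuousOn (fun β => J (mixPolicy π₁ π₂ β) i) (Set.Icc 0 1) := by
    intro i
    simp only [hJi]
    refine continuousOn_finsetSum _ fun s _ => continuousOn_const.mul ?_
    have h := continuousOn_mixPolicy_value hP0 hP1 hγ0 hγ1 h₁.1 h₂.1
      (v := fun β s => ∑ j, (Pi.single i 1 : Fin D → ℝ) j * V (mixPolicy π₁ π₂ β) s j)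
      (fun β hβ => hscal (Pi.single i 1) _ (h₁.1.mixPolicy h₂.1 hβ)) s
    simpa [Pi.single_apply] using h
  have hmix0 : mixPolicy π₁ π₂ 0 = π₂ := by funext s a; simp [mixPolicy]
  have hmix1 : mixPolicy π₁ π₂ 1 = π₁ := by funext s a; simp [mixPolicy]
  intro α hα
  by_cases hJJ : J π₁ = J π₂
  · refine ⟨0, by simp, ?_⟩
    change _ = J (mixPolicy π₁ π₂ 0)
    rw [hmix0, hJJ, ← add_smul, add_sub_cancel, one_smul]
  obtain ⟨i, hi⟩ := Function.ne_iff.1 hJJ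
  have hivt := intermediate_value_uIcc (a := (0 : ℝ)) (b := 1)
    (f := fun β => J (mixPolicy π₁ π₂ β) i) (by simpa using hcont i)
  simp only [hmix0, hmix1, Set.uIcc_of_le zero_le_one] at hivt
  have htarget : α * J π₁ i + (1 - α) * J π₂ i ∈ Set.uIcc (J π₂ i) (J π₁ i) := by
    rw [← segment_eq_uIcc]
    exact ⟨1 - α, α, sub_nonneg.2 hα.2, hα.1, by ring, by simp only [smul_eq_mul]; ring⟩
  obtain ⟨β, hβ, hβi⟩ := hivt htarget
  obtain ⟨α', -, hα'⟩ := hseg β hβ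
  have hαα' : α' = α := by
    have h := congrFun hα' i
    simp only [Pi.add_apply, Pi.smul_apply, smul_eq_mul] at h hβi
    rw [h] at hβi
    have : (α' - α) * (J π₁ i - J π₂ i) = 0 := by linarith
    exact sub_eq_zero.1 ((mul_eq_zero.1 this).resolve_right (sub_ne_zero.2 hi))
  exact ⟨β, hβ, by rw [← hαα', ← hα']; rfl⟩
end

section
/- Consider a finite discounted MO-MDP. Let π₁ and π₂ be deterministic stationary policies that differ at exactly one state, i.e., π₁(s,·) = π₂(s,·) for all states except a single state s₀. Then the value functions of their mixtures trace exactly the straight segment between V^{π₁} and V^{π₂}: {V^{α π₁ + (1−α) π₂} : α ∈ [0,1]} = {t V^{π₁} + (1−t) V^{π₂} : t ∈ [0,1]} (as subsets of the space of maps S → ℝ^D). Consequently, for any initial distribution μ, {J^{α π₁ + (1−α) π₂}(μ) : α ∈ [0,1]} equals the segment between J^{π₁}(μ) and J^{π₂}(μ). -/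
open Finset

/-- Maximum principle for discounted substochastic averages. -/
lemma abs_le_of_discounted_average {S : Type*} [Fintype S]
    {Q : S → S → ℝ} (hQ0 : ∀ s s', 0 ≤ Q s s') (hQ1 : ∀ s, ∑ s', Q s s' = 1)
    {γ : ℝ} (hγ0 : 0 ≤ γ) (hγ1 : γ < 1) {c : ℝ} (hc : 0 ≤ c) {f : S → ℝ}
    (hf : ∀ s, |f s| ≤ c ∨ f s = γ * ∑ s', Q s s' * f s') (s : S) : |f s| ≤ c := by
  have : Nonempty S := ⟨s⟩
  obtain ⟨m, hm⟩ := Finite.exists_max fun s => |f s|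
  refine (hm s).trans ?_
  rcases hf m with h | h
  · exact h
  · have hle : |∑ s', Q m s' * f s'| ≤ |f m| := by
      calc |∑ s', Q m s' * f s'| ≤ ∑ s', |Q m s' * f s'| := Finset.abs_sum_le_sum_abs _ _
        _ ≤ ∑ s', Q m s' * |f m| := by
            refine Finset.sum_le_sum fun s' _ => ?_
            rw [abs_mul, abs_of_nonneg (hQ0 m s')]
            exact mul_le_mul_of_nonneg_left (hm s') (hQ0 m s')
        _ = |f m| := by rw [← Finset.sum_mul, hQ1, one_mul]
    have h' : |f m| ≤ γ * |f m| := by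
      conv_lhs => rw [h, abs_mul, abs_of_nonneg hγ0]
      exact mul_le_mul_of_nonneg_left hle hγ0
    nlinarith [abs_nonneg (f m)]

/-- A discounted Bellman equation has at most one solution. -/
lemma eq_of_discounted_bellman {S : Type*} [Fintype S]
    {Q : S → S → ℝ} (hQ0 : ∀ s s', 0 ≤ Q s s') (hQ1 : ∀ s, ∑ s', Q s s' = 1)
    {γ : ℝ} (hγ0 : 0 ≤ γ) (hγ1 : γ < 1) {R f g : S → ℝ}
    (hf : ∀ s, f s = R s + γ * ∑ s', Q s s' * f s')
    (hg : ∀ s, g s = R s + γ * ∑ s', Q s s' * g s') (s : S) : f s = g s := by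
  have := abs_le_of_discounted_average hQ0 hQ1 hγ0 hγ1 le_rfl (f := fun s => f s - g s)
    (fun s => Or.inr (by
      simp only [mul_sub, Finset.sum_sub_distrib]
      linarith [hf s, hg s])) s
  exact sub_eq_zero.mp (abs_nonpos_iff.mp this)

/-- The discounted hitting function of `s₀`: the solution of the discounted Dirichlet problem
with value `1` at `s₀`. -/
lemma exists_discounted_hitting {S : Type*} [Fintype S]
    {Q : S → S → ℝ} (hQ0 : ∀ s s', 0 ≤ Q s s') (hQ1 : ∀ s, ∑ s', Q s s' = 1)
    {γ : ℝ} (hγ0 : 0 ≤ γ) (hγ1 : γ < 1) (s₀ : S) :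
    ∃ h : S → ℝ, h s₀ = 1 ∧ (∀ s, s ≠ s₀ → h s = γ * ∑ s', Q s s' * h s') ∧
      ∀ s, |h s| ≤ 1 := by
  classical
  let L : (S → ℝ) →ₗ[ℝ] (S → ℝ) :=
    { toFun := fun h s => if s = s₀ then h s else h s - γ * ∑ s', Q s s' * h s'
      map_add' := fun x y => by
        ext s
        by_cases hs : s = s₀
        · simp [hs]
        · simp only [hs, if_false, Pi.add_apply, mul_add, Finset.sum_add_distrib]
          ring
      map_smul' := fun c x => by
        ext s
        by_cases hs : s = s₀
        · simp [hs]
        · simp only [hs, if_false, Pi.smul_apply, smul_eq_mul, RingHom.id_apply,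
            mul_left_comm _ c, ← Finset.mul_sum]
          ring }
  have hL (h : S → ℝ) (s : S) :
      L h s = if s = s₀ then h s else h s - γ * ∑ s', Q s s' * h s' := rfl
  have hinj : Function.Injective L := by
    refine (injective_iff_map_eq_zero L).mpr fun x hx => ?_
    ext s
    refine abs_nonpos_iff.mp
      (abs_le_of_discounted_average hQ0 hQ1 hγ0 hγ1 le_rfl (fun s => ?_) s)
    have hxs := congrFun hx s
    rw [hL] at hxs
    by_cases hs : s = s₀
    · left; simpa [hs] using hxs
    · right; simpa [hs, sub_eq_zero] using hxs
  obtain ⟨h, hh⟩ := LinearMap.injective_iff_surjective.mp hinj (Pi.single s₀ 1)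
  have h0 : h s₀ = 1 := by simpa [hL] using congrFun hh s₀
  have hs' (s : S) (hs : s ≠ s₀) : h s = γ * ∑ s', Q s s' * h s' := by
    simpa [hL, hs, sub_eq_zero] using congrFun hh s
  refine ⟨h, h0, hs', abs_le_of_discounted_average hQ0 hQ1 hγ0 hγ1 zero_le_one fun s => ?_⟩
  by_cases hs : s = s₀
  · left; simp [hs, h0]
  · exact Or.inr (hs' s hs)

/-- Two discounted Bellman equations that agree off `s₀` have solutions whose difference is a
multiple of the discounted hitting function of `s₀`. -/
lemma sub_eq_mul_discounted_hitting {S : Type*} [Fintype S]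
    {Q₁ Q₂ : S → S → ℝ} (hQ0 : ∀ s s', 0 ≤ Q₁ s s') (hQ1 : ∀ s, ∑ s', Q₁ s s' = 1)
    {γ : ℝ} (hγ0 : 0 ≤ γ) (hγ1 : γ < 1) {s₀ : S} {R₁ R₂ v₁ v₂ h : S → ℝ}
    (hQ : ∀ s, s ≠ s₀ → Q₁ s = Q₂ s) (hR : ∀ s, s ≠ s₀ → R₁ s = R₂ s)
    (hv₁ : ∀ s, v₁ s = R₁ s + γ * ∑ s', Q₁ s s' * v₁ s')
    (hv₂ : ∀ s, v₂ s = R₂ s + γ * ∑ s', Q₂ s s' * v₂ s')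
    (h0 : h s₀ = 1) (hh : ∀ s, s ≠ s₀ → h s = γ * ∑ s', Q₁ s s' * h s') (s : S) :
    v₁ s - v₂ s = (v₁ s₀ - v₂ s₀) * h s := by
  have := abs_le_of_discounted_average hQ0 hQ1 hγ0 hγ1 le_rfl
    (f := fun s => v₁ s - v₂ s - (v₁ s₀ - v₂ s₀) * h s) (fun s => by
      by_cases hs : s = s₀
      · left; simp [hs, h0]
      · right
        have e₂ := hv₂ s
        rw [← hQ s hs, ← hR s hs] at e₂
        simp only [mul_sub, Finset.sum_sub_distrib, mul_left_comm (Q₁ s _) (v₁ s₀ - v₂ s₀),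
          ← Finset.mul_sum]
        linear_combination hv₁ s - e₂ - (v₁ s₀ - v₂ s₀) * hh s hs) s
  exact sub_eq_zero.mp (abs_nonpos_iff.mp this)

/-- Solution of a mixture of two discounted Bellman equations that agree off `s₀`. -/
lemma mixture_bellman_eq_segment {S : Type*} [Fintype S]
    {Q₁ Q₂ : S → S → ℝ} (hQ0 : ∀ s s', 0 ≤ Q₁ s s') (hQ1 : ∀ s, ∑ s', Q₁ s s' = 1)
    (hQ0' : ∀ s s', 0 ≤ Q₂ s s') (hQ1' : ∀ s, ∑ s', Q₂ s s' = 1)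
    {γ : ℝ} (hγ0 : 0 ≤ γ) (hγ1 : γ < 1) {s₀ : S} {R₁ R₂ v₁ v₂ v h : S → ℝ}
    (hQ : ∀ s, s ≠ s₀ → Q₁ s = Q₂ s) (hR : ∀ s, s ≠ s₀ → R₁ s = R₂ s)
    (hv₁ : ∀ s, v₁ s = R₁ s + γ * ∑ s', Q₁ s s' * v₁ s')
    (hv₂ : ∀ s, v₂ s = R₂ s + γ * ∑ s', Q₂ s s' * v₂ s')
    (h0 : h s₀ = 1) (hh : ∀ s, s ≠ s₀ → h s = γ * ∑ s', Q₁ s s' * h s')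
    {α t : ℝ} (hα : α ∈ Set.Icc (0 : ℝ) 1)
    (hv : ∀ s, v s = (α * R₁ s + (1 - α) * R₂ s) +
      γ * ∑ s', (α * Q₁ s s' + (1 - α) * Q₂ s s') * v s')
    (ht : t * (α * (1 - γ * ∑ s', Q₁ s₀ s' * h s') +
      (1 - α) * (1 - γ * ∑ s', Q₂ s₀ s' * h s')) = α * (1 - γ * ∑ s', Q₁ s₀ s' * h s'))
    (s : S) : v s = t * v₁ s + (1 - t) * v₂ s := by
  have hα' : 0 ≤ 1 - α := sub_nonneg.mpr hα.2
  have hΔ := sub_eq_mul_discounted_hitting hQ0 hQ1 hγ0 hγ1 hQ hR hv₁ hv₂ h0 hh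
  refine eq_of_discounted_bellman (Q := fun s s' => α * Q₁ s s' + (1 - α) * Q₂ s s')
    (fun s s' => add_nonneg (mul_nonneg hα.1 (hQ0 s s')) (mul_nonneg hα' (hQ0' s s')))
    (fun s => by simp [Finset.sum_add_distrib, ← Finset.mul_sum, hQ1, hQ1'])
    hγ0 hγ1 hv (g := fun s => t * v₁ s + (1 - t) * v₂ s) (fun s => ?_) s
  have expand (a b c d : ℝ) (x y : S → ℝ) (p q : S → ℝ) :
      ∑ s', (a * p s' + b * q s') * (c * x s' + d * y s') =
        a * c * ∑ s', p s' * x s' + a * d * ∑ s', p s' * y s' +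
          b * c * ∑ s', q s' * x s' + b * d * ∑ s', q s' * y s' := by
    simp only [Finset.mul_sum, ← Finset.sum_add_distrib]
    exact Finset.sum_congr rfl fun _ _ => by ring
  rw [expand]
  by_cases hs : s = s₀
  · subst hs
    have hcross (p : S → ℝ) : ∑ s', p s' * v₁ s' - ∑ s', p s' * v₂ s' =
        (v₁ s - v₂ s) * ∑ s', p s' * h s' := by
      rw [Finset.mul_sum, ← Finset.sum_sub_distrib]
      exact Finset.sum_congr rfl fun s' _ => by linear_combination p s' * hΔ s'
    linear_combination α * hv₁ s + (1 - α) * hv₂ s + (v₁ s - v₂ s) * ht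
      + γ * α * (1 - t) * hcross (Q₁ s) - γ * (1 - α) * t * hcross (Q₂ s)
  · have e₂ := hv₂ s
    have e₁ := hv₁ s
    rw [← hQ s hs, ← hR s hs] at e₂ ⊢
    linear_combination t * e₁ + (1 - t) * e₂

/-- A positively weighted reparametrization of the unit interval stays in it, with positive
denominator. -/
lemma div_weighted_mem_Icc {x y a : ℝ} (hx : 0 < x) (hy : 0 < y) (ha : a ∈ Set.Icc (0 : ℝ) 1) :
    a * x / (a * x + (1 - a) * y) ∈ Set.Icc (0 : ℝ) 1 ∧ 0 < a * x + (1 - a) * y := by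
  have h1 : 0 ≤ a * x := mul_nonneg ha.1 hx.le
  have h2 : 0 ≤ (1 - a) * y := mul_nonneg (sub_nonneg.mpr ha.2) hy.le
  have h3 : 0 < a * x + (1 - a) * y := by
    rcases ha.1.eq_or_lt with h | h
    · simpa [← h] using hy
    · linarith [mul_pos h hx]
  exact ⟨⟨by positivity, (div_le_one h3).mpr (by linarith)⟩, h3⟩

/-- If the deterministic policies `π₁` and `π₂` differ at exactly one state, then the value
functions of their mixtures trace exactly the straight segment between `V^{π₁}` and `V^{π₂}`;
consequently, for any initial distribution `μ`, the returns of the mixtures trace the segment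
between `J^{π₁}(μ)` and `J^{π₂}(μ)`. -/
theorem mixtures_trace_segment_of_differ_at_one_state
    {S A : Type*} [Fintype S] [Fintype A] [Nonempty S] [Nonempty A]
    {D : ℕ} (hD : 1 ≤ D)
    (P : S → A → S → ℝ)
    (hP0 : ∀ s a s', 0 ≤ P s a s') (hP1 : ∀ s a, ∑ s', P s a s' = 1)
    (r : S → A → Fin D → ℝ)
    (γ : ℝ) (hγ0 : 0 ≤ γ) (hγ1 : γ < 1)
    (V : (S → A → ℝ) → S → Fin D → ℝ)
    (hV : ∀ π : S → A → ℝ, IsPolicy π → ∀ s,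
      V π s = (∑ a, π s a • r s a) + γ • ∑ s', (∑ a, π s a * P s a s') • V π s')
    (π₁ π₂ : S → A → ℝ) (h₁ : IsDetPolicy π₁) (h₂ : IsDetPolicy π₂)
    (s₀ : S) (hdiff : π₁ s₀ ≠ π₂ s₀) (hsame : ∀ s, s ≠ s₀ → π₁ s = π₂ s) :
    ({f | ∃ α ∈ Set.Icc (0 : ℝ) 1,
        f = V (fun s a => α * π₁ s a + (1 - α) * π₂ s a)} =
      {f | ∃ t ∈ Set.Icc (0 : ℝ) 1, f = t • V π₁ + (1 - t) • V π₂}) ∧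
    (∀ μ : S → ℝ, (∀ s, 0 ≤ μ s) → ∑ s, μ s = 1 →
      {x | ∃ α ∈ Set.Icc (0 : ℝ) 1,
          x = ∑ s, μ s • V (fun s a => α * π₁ s a + (1 - α) * π₂ s a) s} =
        {x | ∃ t ∈ Set.Icc (0 : ℝ) 1,
          x = t • (∑ s, μ s • V π₁ s) + (1 - t) • (∑ s, μ s • V π₂ s)}) := by
  obtain ⟨hp₁, -⟩ := h₁
  obtain ⟨hp₂, -⟩ := h₂
  let Q (π : S → A → ℝ) (s s' : S) : ℝ := ∑ a, π s a * P s a s'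
  have hQ0 {π : S → A → ℝ} (hπ : IsPolicy π) (s s' : S) : 0 ≤ Q π s s' :=
    Finset.sum_nonneg fun a _ => mul_nonneg (hπ.1 s a) (hP0 s a s')
  have hQ1 {π : S → A → ℝ} (hπ : IsPolicy π) (s : S) : ∑ s', Q π s s' = 1 := by
    simp only [Q]
    rw [Finset.sum_comm]
    simp [← Finset.mul_sum, hP1, hπ.2]
  have hB {π : S → A → ℝ} (hπ : IsPolicy π) (d : Fin D) (s : S) :
      V π s d = ∑ a, π s a * r s a d + γ * ∑ s', Q π s s' * V π s' d := by
    simpa [Finset.sum_apply, Q] using congrFun (hV π hπ s) d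
  have hmix {α : ℝ} (hα : α ∈ Set.Icc (0 : ℝ) 1) :
      IsPolicy fun s a => α * π₁ s a + (1 - α) * π₂ s a :=
    ⟨fun s a => add_nonneg (mul_nonneg hα.1 (hp₁.1 s a))
      (mul_nonneg (sub_nonneg.mpr hα.2) (hp₂.1 s a)),
      fun s => by simp [Finset.sum_add_distrib, ← Finset.mul_sum, hp₁.2, hp₂.2]⟩
  have hsum (α : ℝ) (s : S) (x : A → ℝ) :
      ∑ a, (α * π₁ s a + (1 - α) * π₂ s a) * x a =
        α * ∑ a, π₁ s a * x a + (1 - α) * ∑ a, π₂ s a * x a := by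
    simp only [Finset.mul_sum, ← Finset.sum_add_distrib]
    exact Finset.sum_congr rfl fun _ _ => by ring
  obtain ⟨h, h0, hh, hle⟩ := exists_discounted_hitting (hQ0 hp₁) (hQ1 hp₁) hγ0 hγ1 s₀
  have hpos {π : S → A → ℝ} (hπ : IsPolicy π) : 0 < 1 - γ * ∑ s', Q π s₀ s' * h s' := by
    have : ∑ s', Q π s₀ s' * h s' ≤ 1 := by
      rw [← hQ1 hπ s₀]
      exact Finset.sum_le_sum fun s' _ =>
        mul_le_of_le_one_right (hQ0 hπ s₀ s') (le_of_abs_le (hle s'))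
    nlinarith
  set x := 1 - γ * ∑ s', Q π₁ s₀ s' * h s'
  set y := 1 - γ * ∑ s', Q π₂ s₀ s' * h s'
  have hx0 : 0 < x := hpos hp₁
  have hy0 : 0 < y := hpos hp₂
  have key {α t : ℝ} (hα : α ∈ Set.Icc (0 : ℝ) 1)
      (ht : t * (α * x + (1 - α) * y) = α * x) :
      V (fun s a => α * π₁ s a + (1 - α) * π₂ s a) = t • V π₁ + (1 - t) • V π₂ := by
    ext s d
    refine mixture_bellman_eq_segment (hQ0 hp₁) (hQ1 hp₁) (hQ0 hp₂) (hQ1 hp₂) hγ0 hγ1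
      (fun s hs => ?_) (fun s hs => ?_) (hB hp₁ d) (hB hp₂ d) h0 hh hα
      (v := fun s => V (fun s a => α * π₁ s a + (1 - α) * π₂ s a) s d) (fun s => ?_) ht s
    · simp only [Q, hsame s hs]
    · simp only [hsame s hs]
    · have hb := hB (hmix hα) d s
      simp only [Q, hsum] at hb
      exact hb
  have forward {α : ℝ} (hα : α ∈ Set.Icc (0 : ℝ) 1) : ∃ t ∈ Set.Icc (0 : ℝ) 1,
      V (fun s a => α * π₁ s a + (1 - α) * π₂ s a) = t • V π₁ + (1 - t) • V π₂ := by
    obtain ⟨hm, hne⟩ := div_weighted_mem_Icc hx0 hy0 hα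
    exact ⟨_, hm, key hα (div_mul_cancel₀ _ hne.ne')⟩
  have backward {t : ℝ} (ht : t ∈ Set.Icc (0 : ℝ) 1) : ∃ α ∈ Set.Icc (0 : ℝ) 1,
      V (fun s a => α * π₁ s a + (1 - α) * π₂ s a) = t • V π₁ + (1 - t) • V π₂ := by
    obtain ⟨hm, hne⟩ := div_weighted_mem_Icc hy0 hx0 ht
    refine ⟨_, hm, key hm ?_⟩
    field_simp
    ring
  have hJ (μ : S → ℝ) (t : ℝ) : ∑ s, μ s • (t • V π₁ + (1 - t) • V π₂) s =
      t • (∑ s, μ s • V π₁ s) + (1 - t) • (∑ s, μ s • V π₂ s) := by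
    simp only [Pi.add_apply, Pi.smul_apply, smul_add, Finset.sum_add_distrib, Finset.smul_sum,
      smul_comm (μ _)]
  refine ⟨Set.ext fun f => ⟨?_, ?_⟩, fun μ _ _ => Set.ext fun z => ⟨?_, ?_⟩⟩
  · rintro ⟨α, hα, rfl⟩
    exact forward hα
  · rintro ⟨t, ht, rfl⟩
    obtain ⟨α, hα, e⟩ := backward ht
    exact ⟨α, hα, e.symm⟩
  · rintro ⟨α, hα, rfl⟩
    obtain ⟨t, ht, e⟩ := forward hα
    exact ⟨t, ht, by rw [e, hJ]⟩
  · rintro ⟨t, ht, rfl⟩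
    obtain ⟨α, hα, e⟩ := backward ht
    exact ⟨α, hα, by rw [e, hJ]⟩
end

section
/- Let V ⊆ ℝ^D be a nonempty finite set and C = convexHull(V). Suppose at least two extreme points of C are Pareto optimal in C, and let x be an extreme point of C that is Pareto optimal in C. Then there exists an extreme point y of C with y ≠ x such that the segment [x,y] is a face of C and every point of the segment [x,y] is Pareto optimal in C. -/
open Finset

/-- `F` is a face of the convex set `C`: the intersection of `C` with a supporting
hyperplane. -/
def IsFaceOf {D : ℕ} (F C : Set (Fin D → ℝ)) : Prop :=
  ∃ (w : Fin D → ℝ) (c : ℝ), (∀ y ∈ C, ∑ i, w i * y i ≤ c) ∧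
    F = C ∩ {x | ∑ i, w i * x i = c}

/-- An extreme point of a convex hull is not in the hull of the other generators. -/
lemma notMem_convexHull_sdiff_of_mem_extremePoints {E : Type*}
    [AddCommGroup E] [Module ℝ E] {V : Set E} {x : E}
    (hx : x ∈ (convexHull ℝ V).extremePoints ℝ) : x ∉ convexHull ℝ (V \ {x}) := fun h =>
  (((convex_convexHull ℝ V).mem_extremePoints_iff_mem_sdiff_convexHull_sdiff).1 hx).2
    (convexHull_mono (Set.sdiff_subset_sdiff_left (subset_convexHull ℝ V)) h)

section LocallyConvex

variable {E : Type*} [AddCommGroup E] [Module ℝ E] [TopologicalSpace E]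

/-- A linear bound on a set extends to its convex hull. -/
lemma StrongDual.le_of_mem_convexHull {V : Set E} (f : StrongDual ℝ E) {c : ℝ}
    (h : ∀ v ∈ V, f v ≤ c) : ∀ z ∈ convexHull ℝ V, f z ≤ c :=
  convexHull_min h (convex_halfSpace_le f.toLinearMap.isLinear c)

variable [T2Space E] [IsTopologicalAddGroup E] [ContinuousSMul ℝ E] [LocallyConvexSpace ℝ E]

/-- A continuous linear functional attains its maximum over a nonempty compact set at an
extreme point. -/
lemma IsCompact.exists_mem_extremePoints_forall_le {K : Set E} (hK : IsCompact K)
    (hne : K.Nonempty) (f : StrongDual ℝ E) :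
    ∃ p ∈ K.extremePoints ℝ, ∀ z ∈ K, f z ≤ f p := by
  have hexp : IsExposed ℝ K (f.toExposed K) := ContinuousLinearMap.toExposed.isExposed
  obtain ⟨q, hq, hmax⟩ := hK.exists_isMaxOn hne f.continuous.continuousOn
  obtain ⟨p, hp⟩ := (hexp.isCompact hK).extremePoints_nonempty ⟨q, hq, fun z hz => hmax hz⟩
  exact ⟨p, hexp.isExtreme.extremePoints_subset_extremePoints hp, hp.1.2⟩

/-- A point outside the convex hull of a finite set is strictly separated from that set. -/
lemma Set.Finite.exists_forall_lt_of_notMem_convexHull {S : Set E} (hS : S.Finite) {x : E}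
    (hx : x ∉ convexHull ℝ S) : ∃ f : StrongDual ℝ E, ∀ v ∈ S, f v < f x := by
  obtain ⟨f, u, h, hu⟩ := geometric_hahn_banach_closed_point (convex_convexHull ℝ S)
    (hS.isCompact_convexHull ℝ).isClosed hx
  exact ⟨f, fun v hv => (h v (subset_convexHull ℝ S hv)).trans hu⟩

/-- Let `x` be the unique maximizer of `f` over a finite set `V`, and let `g` be any linear
functional. Then the polytope spanned by `V` has an edge `[x, y]` on which some combination
`g + R • f` attains its maximum over the polytope. -/
lemma Set.Finite.exists_edge_of_forall_lt {V : Set E} (hV : V.Finite) {x y₀ : E} (hxV : x ∈ V)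
    (hy₀ : y₀ ∈ V) (hne : y₀ ≠ x) {f : StrongDual ℝ E} (hf : ∀ v ∈ V \ {x}, f v < f x)
    (g : StrongDual ℝ E) :
    ∃ y ∈ (convexHull ℝ V).extremePoints ℝ, y ≠ x ∧
      (∃ h : StrongDual ℝ E, (∀ z ∈ convexHull ℝ V, h z ≤ h x) ∧
        segment ℝ x y = convexHull ℝ V ∩ {z | h z = h x}) ∧
      ∃ R : ℝ, (∀ z ∈ convexHull ℝ V, (g + R • f) z ≤ (g + R • f) x) ∧
        (g + R • f) y = (g + R • f) x := by
  let π : E → E := fun v => (f x - f v)⁻¹ • (v - x)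
  have hπ (φ : StrongDual ℝ E) {v : E} (hv : v ∈ V \ {x}) :
      φ v - φ x = (f x - f v) * φ (π v) := by
    have := (sub_pos.2 (hf v hv)).ne'
    simp only [π, map_smul, map_sub, smul_eq_mul]
    field_simp
  have hfin : (π '' (V \ {x})).Finite := hV.sdiff.image π
  obtain ⟨p, hp, hpmax⟩ := (hfin.isCompact_convexHull ℝ).exists_mem_extremePoints_forall_le
    (convexHull_nonempty_iff.2 ⟨π y₀, y₀, ⟨hy₀, hne⟩, rfl⟩) g
  obtain ⟨k, hk⟩ := hfin.sdiff.exists_forall_lt_of_notMem_convexHull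
    (notMem_convexHull_sdiff_of_mem_extremePoints hp)
  obtain ⟨v₀, hv₀, hv₀p⟩ := extremePoints_convexHull_subset hp
  let h : StrongDual ℝ E := k + k p • f
  have hfπ {v : E} (hv : v ∈ V \ {x}) : f (π v) = -1 := by
    have h0 := sub_pos.2 (hf v hv)
    have := hπ f hv
    apply mul_left_cancel₀ h0.ne'
    linarith
  have hh_eq {v : E} (hv : v ∈ V \ {x}) (hvp : π v = p) : h v = h x := by
    have := hπ h hv
    have h1 : h (π v) = 0 := by simp [h, ← hvp, hfπ hv]
    rw [h1, mul_zero] at this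
    linarith
  have hh_lt {v : E} (hv : v ∈ V \ {x}) (hvp : π v ≠ p) : h v < h x := by
    have := hπ h hv
    have h1 : h (π v) < 0 := by
      have := hk (π v) ⟨⟨v, hv, rfl⟩, hvp⟩
      simp [h, hfπ hv]
      linarith
    have := mul_neg_of_pos_of_neg (sub_pos.2 (hf v hv)) h1
    linarith
  have hh_le : ∀ z ∈ convexHull ℝ V, h z ≤ h x := by
    refine h.le_of_mem_convexHull fun v hv => ?_
    by_cases hvx : v = x
    · rw [hvx]
    by_cases hvp : π v = p
    · exact (hh_eq ⟨hv, hvx⟩ hvp).le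
    · exact (hh_lt ⟨hv, hvx⟩ hvp).le
  have hxC := subset_convexHull ℝ V hxV
  have hCc := hV.isCompact_convexHull ℝ
  set B := convexHull ℝ V ∩ {z | h z = h x} with hB
  have hBexp : IsExposed ℝ (convexHull ℝ V) B := fun _ => ⟨h, by
    ext z
    refine ⟨fun hz => ⟨hz.1, fun y hy => (hh_le y hy).trans_eq hz.2.symm⟩,
      fun hz => ⟨hz.1, (hh_le z hz.1).antisymm (hz.2 x hxC)⟩⟩⟩
  have hBc := hBexp.isCompact hCc
  have hBconv := hBexp.convex (convex_convexHull ℝ V)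
  have hxB : x ∈ B := ⟨hxC, rfl⟩
  have hBext {v : E} (hv : v ∈ B.extremePoints ℝ) (hvx : v ≠ x) : v ∈ V \ {x} ∧ π v = p := by
    have hvV := extremePoints_convexHull_subset
      (hBexp.isExtreme.extremePoints_subset_extremePoints hv)
    refine ⟨⟨hvV, hvx⟩, ?_⟩
    by_contra hvp
    exact (hh_lt ⟨hvV, hvx⟩ hvp).ne hv.1.2
  obtain ⟨y, hy, hymax⟩ := hBc.exists_mem_extremePoints_forall_le ⟨x, hxB⟩ (-f)
  have hyx : y ≠ x := by
    rintro rfl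
    have := hymax v₀ ⟨subset_convexHull ℝ V hv₀.1, hh_eq hv₀ hv₀p⟩
    have := hf v₀ hv₀
    simp at *
    linarith
  obtain ⟨hyV, hyp⟩ := hBext hy hyx
  have hfy := sub_pos.2 (hf y hyV)
  refine ⟨y, hBexp.isExtreme.extremePoints_subset_extremePoints hy, hyx, ⟨h, hh_le, ?_⟩,
    g p, ?_, ?_⟩
  · refine (hBconv.segment_subset hxB hy.1).antisymm ?_
    rw [← closure_convexHull_extremePoints hBc hBconv]
    refine closure_minimal (convexHull_min (fun v hv => ?_) (convex_segment x y)) ?_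
    · by_cases hvx : v = x
      · rw [hvx]
        exact left_mem_segment ℝ x y
      obtain ⟨hvV, hvp⟩ := hBext hv hvx
      have hfv := sub_pos.2 (hf v hvV)
      have hle : f x - f v ≤ f x - f y := by
        have := hymax v hv.1
        simp at this
        linarith
      rw [segment_eq_image']
      refine ⟨(f x - f v) / (f x - f y), ⟨by positivity, (div_le_one hfy).2 hle⟩, ?_⟩
      have h1 : (f x - f y)⁻¹ • (y - x) = (f x - f v)⁻¹ • (v - x) := hyp.trans hvp.symm
      simp only
      rw [div_eq_mul_inv, mul_smul, h1, smul_inv_smul₀ hfv.ne', add_sub_cancel]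
    · rw [← convexHull_pair]
      exact ((Set.toFinite {x, y}).isCompact_convexHull ℝ).isClosed
  · refine (g + g p • f).le_of_mem_convexHull fun v hv => ?_
    by_cases hvx : v = x
    · rw [hvx]
    have h1 := hπ g ⟨hv, hvx⟩
    have h2 := hpmax (π v) (subset_convexHull ℝ _ ⟨v, ⟨hv, hvx⟩, rfl⟩)
    have h3 := mul_le_mul_of_nonneg_left h2 (sub_pos.2 (hf v ⟨hv, hvx⟩)).le
    simp
    linarith
  · have h1 := hπ g hyV
    rw [hyp] at h1
    simp
    linarith

end LocallyConvex

lemma StrongDual.apply_eq_sum_single {D : ℕ} (f : StrongDual ℝ (Fin D → ℝ)) (z : Fin D → ℝ) :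
    f z = ∑ i, f (Pi.single i 1) * z i := by
  conv_lhs => rw [pi_eq_sum_univ' z]
  simp [mul_comm]

/-- A maximizer of a linear functional with positive coefficients is Pareto optimal. -/
lemma ParetoOptimalIn.of_forall_le {D : ℕ} {C : Set (Fin D → ℝ)} {z : Fin D → ℝ}
    (f : StrongDual ℝ (Fin D → ℝ)) (hpos : ∀ i, 0 < f (Pi.single i 1))
    (hf : ∀ y ∈ C, f y ≤ f z) : ParetoOptimalIn z C := by
  rintro y hy ⟨hle, hne⟩
  obtain ⟨i, hi⟩ := Function.ne_iff.1 hne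
  refine (hf y hy).not_gt ?_
  rw [f.apply_eq_sum_single, f.apply_eq_sum_single]
  exact Finset.sum_lt_sum (fun j _ => mul_le_mul_of_nonneg_left (hle j) (hpos j).le)
    ⟨i, Finset.mem_univ i, mul_lt_mul_of_pos_left ((hle i).lt_of_ne' hi) (hpos i)⟩

/-- A Pareto optimal extreme point of a polytope is the unique maximizer, among the
generators, of some linear functional with positive coefficients. -/
lemma ParetoOptimalIn.exists_pos_forall_lt {D : ℕ} {V : Set (Fin D → ℝ)} (hV : V.Finite)
    {x : Fin D → ℝ} (hx : x ∈ (convexHull ℝ V).extremePoints ℝ)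
    (hxP : ParetoOptimalIn x (convexHull ℝ V)) :
    ∃ f : StrongDual ℝ (Fin D → ℝ), (∀ i, 0 < f (Pi.single i 1)) ∧
      ∀ v ∈ V \ {x}, f v < f x := by
  have hxV := notMem_convexHull_sdiff_of_mem_extremePoints hx
  let T : Set (Fin D → ℝ) := Set.range fun i => x - Pi.single i 1
  have hT : convexHull ℝ T ⊆ {z | z ≤ x ∧ z ≠ x} := by
    have hT₁ : convexHull ℝ T ⊆ Set.Iic x := by
      refine convexHull_min ?_ (convex_Iic x)
      rintro _ ⟨i, rfl⟩
      simp
    have hT₂ : convexHull ℝ T ⊆ {z | ∑ i, z i ≤ ∑ i, x i - 1} := by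
      refine convexHull_min ?_ (convex_halfSpace_le
        ⟨fun a b => by simp [Finset.sum_add_distrib], fun c a => by simp [Finset.mul_sum]⟩ _)
      rintro _ ⟨i, rfl⟩
      simp
    refine fun z hz => ⟨hT₁ hz, ?_⟩
    rintro rfl
    have := hT₂ hz
    simp at this
    linarith
  have hdisj : x ∉ convexHull ℝ (V \ {x} ∪ T) := by
    intro h
    rcases (V \ {x}).eq_empty_or_nonempty with h0 | h0
    · rw [h0, Set.empty_union] at h
      exact (hT h).2 rfl
    rcases T.eq_empty_or_nonempty with h1 | h1
    · rw [h1, Set.union_empty] at h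
      exact hxV h
    rw [convexHull_union h0 h1, mem_convexJoin] at h
    obtain ⟨a, ha, b, hb, α, β, hα, hβ, hαβ, hab⟩ := h
    obtain ⟨hbx, hbne⟩ := hT hb
    rcases hα.eq_or_lt with rfl | hα
    · obtain rfl : β = 1 := by linarith
      exact hbne (by simpa using hab)
    refine hxP a (convexHull_mono Set.sdiff_subset ha) ⟨fun i => ?_, fun h => hxV (h ▸ ha)⟩
    have h2 := congrFun hab i
    simp only [Pi.add_apply, Pi.smul_apply, smul_eq_mul] at h2
    have h3 := mul_le_mul_of_nonneg_left (hbx i) hβ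
    refine le_of_mul_le_mul_left ?_ hα
    have h4 : (α + β) * x i = x i := by rw [hαβ, one_mul]
    linarith
  obtain ⟨f, hf⟩ := (hV.sdiff.union (Set.finite_range _)).exists_forall_lt_of_notMem_convexHull
    hdisj
  refine ⟨f, fun i => ?_, fun v hv => hf v (Or.inl hv)⟩
  simpa using hf _ (Or.inr ⟨i, rfl⟩)

/-- If a convex polytope has at least two Pareto optimal extreme points, then any Pareto
optimal extreme point `x` is connected to another extreme point `y` by an edge (a segment
which is a face) consisting entirely of Pareto optimal points. -/
theorem exists_pareto_edge
    {D : ℕ} (V : Set (Fin D → ℝ)) (hfin : V.Finite) (hne : V.Nonempty)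
    (C : Set (Fin D → ℝ)) (hC : C = convexHull ℝ V)
    (hmulti : ∃ x y, x ∈ C.extremePoints ℝ ∧ y ∈ C.extremePoints ℝ ∧ x ≠ y ∧
      ParetoOptimalIn x C ∧ ParetoOptimalIn y C)
    (x : Fin D → ℝ) (hx : x ∈ C.extremePoints ℝ) (hxP : ParetoOptimalIn x C) :
    ∃ y ∈ C.extremePoints ℝ, y ≠ x ∧ IsFaceOf (segment ℝ x y) C ∧
      ∀ z ∈ segment ℝ x y, ParetoOptimalIn z C := by
  subst hC
  obtain ⟨y₀, hy₀, hne₀, hy₀P⟩ : ∃ y₀ ∈ (convexHull ℝ V).extremePoints ℝ, y₀ ≠ x ∧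
      ParetoOptimalIn y₀ (convexHull ℝ V) := by
    obtain ⟨a, b, ha, hb, hab, haP, hbP⟩ := hmulti
    by_cases hax : a = x
    · exact ⟨b, hb, hax ▸ hab.symm, hbP⟩
    · exact ⟨a, ha, hax, haP⟩
  have hxV := extremePoints_convexHull_subset hx
  have hy₀V := extremePoints_convexHull_subset hy₀
  obtain ⟨f, hfpos, hf⟩ := hxP.exists_pos_forall_lt hfin hx
  obtain ⟨g, hgpos, hg⟩ := hy₀P.exists_pos_forall_lt hfin hy₀
  obtain ⟨y, hy, hyx, ⟨h, hle, hface⟩, R, hR, hRy⟩ :=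
    hfin.exists_edge_of_forall_lt hxV hy₀V hne₀ hf g
  refine ⟨y, hy, hyx, ⟨fun i => h (Pi.single i 1), h x, ?_, ?_⟩, fun z hz => ?_⟩
  · simpa only [← h.apply_eq_sum_single] using hle
  · simpa only [← h.apply_eq_sum_single] using hface
  have hRpos : 0 < R := by
    have h1 := hf y₀ ⟨hy₀V, hne₀⟩
    have h2 := hg x ⟨hxV, hne₀.symm⟩
    have h3 := hR y₀ hy₀.1
    simp at h3
    by_contra! hR0
    have := mul_le_mul_of_nonpos_left h1.le hR0
    linarith
  refine ParetoOptimalIn.of_forall_le (g + R • f) (fun i => ?_) fun v hv => ?_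
  · have := mul_pos hRpos (hfpos i)
    simpa using add_pos (hgpos i) this
  · obtain ⟨α, β, -, -, hαβ, rfl⟩ := hz
    rw [map_add, map_smul, map_smul, hRy, ← add_smul, hαβ, one_smul]
    exact hR v hv
end

section
/- Let V ⊆ ℝ^D be a nonempty finite set and C = convexHull(V). Let T ⊆ V be a subset containing every extreme point of C that is Pareto optimal in C. Then every face of C all of whose points are Pareto optimal in C is also a face of convexHull(T). -/
open Finset

/-- A face of a set is an extreme subset of it. -/
theorem IsFaceOf.isExtreme {D : ℕ} {F C : Set (Fin D → ℝ)} (h : IsFaceOf F C) :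
    IsExtreme ℝ C F := by
  obtain ⟨w, c, hw, rfl⟩ := h
  refine ⟨Set.inter_subset_left, ?_⟩
  rintro x hx y hy _ ⟨-, hz⟩ ⟨a, b, ha, hb, hab, rfl⟩
  refine ⟨hx, ?_⟩
  have hsum : w ⬝ᵥ (a • x + b • y) = c := hz
  rw [dotProduct_add, dotProduct_smul, dotProduct_smul, smul_eq_mul, smul_eq_mul] at hsum
  have hxc : w ⬝ᵥ x ≤ c := hw x hx
  have hyc : w ⬝ᵥ y ≤ c := hw y hy
  change w ⬝ᵥ x = c
  obtain rfl : b = 1 - a := by linarith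
  refine le_antisymm hxc ?_
  by_contra! hlt
  nlinarith [mul_pos ha (sub_pos.2 hlt), mul_nonneg hb.le (sub_nonneg.2 hyc)]

/-- A face of a convex set is convex. -/
theorem IsFaceOf.convex {D : ℕ} {F C : Set (Fin D → ℝ)} (h : IsFaceOf F C)
    (hC : Convex ℝ C) : Convex ℝ F := by
  obtain ⟨w, c, -, rfl⟩ := h
  exact hC.inter (convex_hyperplane (dotProductBilin ℝ ℝ w).isLinear c)

/-- A face of a compact set is compact. -/
theorem IsFaceOf.isCompact {D : ℕ} {F C : Set (Fin D → ℝ)} (h : IsFaceOf F C)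
    (hC : IsCompact C) : IsCompact F := by
  obtain ⟨w, c, -, rfl⟩ := h
  exact hC.inter_right (isClosed_eq (by fun_prop) continuous_const)

/-- A face of `C` contained in a subset `S` of `C` is a face of `S`. -/
theorem IsFaceOf.of_subset {D : ℕ} {F S C : Set (Fin D → ℝ)} (h : IsFaceOf F C)
    (hSC : S ⊆ C) (hFS : F ⊆ S) : IsFaceOf F S := by
  obtain ⟨w, c, hw, rfl⟩ := h
  exact ⟨w, c, fun y hy => hw y (hSC hy),
    Set.Subset.antisymm (fun x hx => ⟨hFS hx, hx.2⟩) (fun x hx => ⟨hSC hx.1, hx.2⟩)⟩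

/-- If `T ⊆ V` contains every Pareto optimal extreme point of the polytope
`C = convexHull V`, then every face of `C` all of whose points are Pareto optimal in `C` is
also a face of `convexHull T`. -/
theorem pareto_faces_of_subhull_containing_pareto_vertices
    {D : ℕ} (V : Set (Fin D → ℝ)) (hfin : V.Finite) (hne : V.Nonempty)
    (C : Set (Fin D → ℝ)) (hC : C = convexHull ℝ V)
    (T : Set (Fin D → ℝ)) (hT : T ⊆ V)
    (hTP : ∀ x ∈ C.extremePoints ℝ, ParetoOptimalIn x C → x ∈ T) :
    ∀ F : Set (Fin D → ℝ), IsFaceOf F C → (∀ z ∈ F, ParetoOptimalIn z C) →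
      IsFaceOf F (convexHull ℝ T) := by
  subst hC
  intro F hF hFP
  refine hF.of_subset (convexHull_mono hT) ?_
  have hext : F.extremePoints ℝ ⊆ T := fun x hx =>
    hTP x (hF.isExtreme.extremePoints_subset_extremePoints hx)
      (hFP x (extremePoints_subset hx))
  rw [← closure_convexHull_extremePoints (hF.isCompact (hfin.isCompact_convexHull ℝ))
    (hF.convex (convex_convexHull ℝ V))]
  exact closure_minimal (convexHull_mono hext) ((hfin.subset hT).isClosed_convexHull ℝ)
end

section
/- Consider a finite discounted MO-MDP with initial distribution μ satisfying μ(s) > 0 for every state s. Let π be a deterministic stationary policy such that J^π(μ) is an extreme point of J(μ) and is Pareto optimal in J(μ). Let Π₁(π) be the set of deterministic policies differing from π at exactly one state, and assume the distance-one property at π: every deterministic policy u with J^u(μ) ≠ J^π(μ) such that the segment [J^u(μ), J^π(μ)] is a face of J(μ) belongs to Π₁(π). Let Π_{1,ND}(π) = {u ∈ Π₁(π) : no u' ∈ Π₁(π) has J^{u'}(μ) strictly dominating J^u(μ)}, and let K_ND = convexHull({J^u(μ) : u ∈ Π_{1,ND}(π)} ∪ {J^π(μ)}). Then every point v such that v is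 an extreme point of J(μ), the segment [J^π(μ), v] is a face of J(μ), and every point of this segment is Pareto optimal in J(μ), is an extreme point of K_ND with the segment [J^π(μ), v] a face of K_ND. -/
open Finset

/-- Two policies differ at exactly one state. -/
def DiffersAtExactlyOneState {S A : Type*} (π₁ π₂ : S → A → ℝ) : Prop :=
  ∃ s₀, π₁ s₀ ≠ π₂ s₀ ∧ ∀ s, s ≠ s₀ → π₁ s = π₂ s

/-- Minimum principle: a function dominating its discounted average is nonnegative. -/
theorem nonneg_of_discounted_average_le {S : Type*} [Fintype S] {M : S → S → ℝ} {γ : ℝ}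
    (hM0 : ∀ s t, 0 ≤ M s t) (hM1 : ∀ s, ∑ t, M s t = 1) (hγ0 : 0 ≤ γ) (hγ1 : γ < 1)
    {y : S → ℝ} (hy : ∀ s, γ * ∑ t, M s t * y t ≤ y s) (s : S) : 0 ≤ y s := by
  have : Nonempty S := ⟨s⟩
  obtain ⟨m, hm⟩ := Finite.exists_min y
  have h1 : y m ≤ ∑ t, M m t * y t := by
    calc y m = ∑ t, M m t * y m := by rw [← Finset.sum_mul, hM1, one_mul]
      _ ≤ _ := Finset.sum_le_sum fun t _ => mul_le_mul_of_nonneg_left (hm t) (hM0 m t)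
  have h2 := hy m
  have h3 := mul_le_mul_of_nonneg_left h1 hγ0
  have h4 : 0 ≤ y m := by
    by_contra! h
    nlinarith
  exact h4.trans (hm s)

/-- Uniqueness for the discounted Poisson equation. -/
theorem eq_zero_of_eq_discounted_average {S : Type*} [Fintype S] {M : S → S → ℝ} {γ : ℝ}
    (hM0 : ∀ s t, 0 ≤ M s t) (hM1 : ∀ s, ∑ t, M s t = 1) (hγ0 : 0 ≤ γ) (hγ1 : γ < 1)
    {y : S → ℝ} (hy : ∀ s, y s = γ * ∑ t, M s t * y t) (s : S) : y s = 0 := by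
  refine le_antisymm ?_
    (nonneg_of_discounted_average_le hM0 hM1 hγ0 hγ1 (fun t => (hy t).ge) s)
  have := nonneg_of_discounted_average_le hM0 hM1 hγ0 hγ1 (y := fun t => - y t)
    (fun t => by simp only [mul_neg, Finset.sum_neg_distrib]; rw [← hy t]) s
  linarith

/-- Existence for the discounted Poisson equation. -/
theorem exists_eq_add_discounted_average {S : Type*} [Fintype S] {M : S → S → ℝ} {γ : ℝ}
    (hM0 : ∀ s t, 0 ≤ M s t) (hM1 : ∀ s, ∑ t, M s t = 1) (hγ0 : 0 ≤ γ) (hγ1 : γ < 1)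
    (b : S → ℝ) : ∃ x : S → ℝ, ∀ s, x s = b s + γ * ∑ t, M s t * x t := by
  let L : (S → ℝ) →ₗ[ℝ] (S → ℝ) := LinearMap.id - γ • Matrix.mulVecLin (Matrix.of M)
  have hL : ∀ x s, L x s = x s - γ * ∑ t, M s t * x t := fun x s => by
    simp [L, Matrix.mulVec, dotProduct]
  have hinj : Function.Injective L := by
    rw [injective_iff_map_eq_zero]
    intro x hx
    funext s
    refine eq_zero_of_eq_discounted_average hM0 hM1 hγ0 hγ1 (fun t => ?_) s
    have := hL x t
    rw [hx] at this
    simp only [Pi.zero_apply] at this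
    linarith
  obtain ⟨x, hx⟩ := LinearMap.injective_iff_surjective.mp hinj b
  refine ⟨x, fun s => ?_⟩
  have := hL x s
  rw [hx] at this
  linarith

/-- The discounted expected number of visits to `s₀` is positive, and it is the factor by which
a perturbation located at `s₀` is transferred to the average of the solution. -/
theorem exists_pos_visits {S : Type*} [Fintype S] {M : S → S → ℝ} {γ : ℝ}
    (hM0 : ∀ s t, 0 ≤ M s t) (hM1 : ∀ s, ∑ t, M s t = 1) (hγ0 : 0 ≤ γ) (hγ1 : γ < 1)
    {μ : S → ℝ} (hμ : ∀ s, 0 < μ s) (s₀ : S) :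
    ∃ n : ℝ, 0 < n ∧ ∀ (y : S → ℝ) (d : ℝ), y s₀ = d + γ * ∑ t, M s₀ t * y t →
      (∀ s, s ≠ s₀ → y s = γ * ∑ t, M s t * y t) → ∑ s, μ s * y s = n * d := by
  classical
  obtain ⟨x, hx⟩ := exists_eq_add_discounted_average hM0 hM1 hγ0 hγ1 (Pi.single s₀ (1 : ℝ))
  have hx0 : ∀ s, 0 ≤ x s := nonneg_of_discounted_average_le hM0 hM1 hγ0 hγ1 fun s => by
    have h1 : (0 : ℝ) ≤ (Pi.single s₀ (1 : ℝ) : S → ℝ) s := by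
      by_cases h : s = s₀
      · subst h; simp
      · simp [h]
    have := hx s
    linarith
  have hxs : 0 < x s₀ := by
    have h1 := hx s₀
    have h2 : 0 ≤ γ * ∑ t, M s₀ t * x t :=
      mul_nonneg hγ0 (Finset.sum_nonneg fun t _ => mul_nonneg (hM0 _ _) (hx0 t))
    rw [Pi.single_eq_same] at h1
    linarith
  refine ⟨∑ s, μ s * x s, Finset.sum_pos' (fun s _ => mul_nonneg (hμ s).le (hx0 s))
    ⟨s₀, Finset.mem_univ _, mul_pos (hμ s₀) hxs⟩, fun y d hy₀ hy => ?_⟩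
  have hyx : ∀ s, y s - d * x s = 0 := by
    refine eq_zero_of_eq_discounted_average hM0 hM1 hγ0 hγ1 (y := fun s => y s - d * x s) fun s => ?_
    have hsum : ∑ t, M s t * (y t - d * x t) =
        ∑ t, M s t * y t - d * ∑ t, M s t * x t := by
      rw [Finset.mul_sum, ← Finset.sum_sub_distrib]
      exact Finset.sum_congr rfl fun t _ => by ring
    have hxs := hx s
    rw [hsum]
    by_cases h : s = s₀
    · subst h
      rw [Pi.single_eq_same] at hxs
      linear_combination hy₀ - d * hxs
    · rw [Pi.single_eq_of_ne h] at hxs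
      linear_combination hy s h - d * hxs
  rw [Finset.sum_mul]
  refine Finset.sum_congr rfl fun s _ => ?_
  linear_combination μ s * hyx s

/-- Performance difference formula for two policies agreeing outside one state. -/
theorem exists_pos_performance_difference {S A : Type*} [Fintype S] [Fintype A] {D : ℕ}
    {P : S → A → S → ℝ} (hP0 : ∀ s a s', 0 ≤ P s a s') (hP1 : ∀ s a, ∑ s', P s a s' = 1)
    {r : S → A → Fin D → ℝ} {γ : ℝ} (hγ0 : 0 ≤ γ) (hγ1 : γ < 1)
    {μ : S → ℝ} (hμ : ∀ s, 0 < μ s) {ρ ρ' : S → A → ℝ} (hρ' : IsPolicy ρ')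
    {W W' : S → Fin D → ℝ}
    (hW : ∀ s, W s = (∑ a, ρ s a • r s a) + γ • ∑ s', (∑ a, ρ s a * P s a s') • W s')
    (hW' : ∀ s, W' s = (∑ a, ρ' s a • r s a) + γ • ∑ s', (∑ a, ρ' s a * P s a s') • W' s')
    {s₀ : S} (hoff : ∀ s, s ≠ s₀ → ρ' s = ρ s) :
    ∃ n : ℝ, 0 < n ∧ ∀ i, (∑ s, μ s • W' s) i - (∑ s, μ s • W s) i =
      n * ∑ a, (ρ' s₀ a - ρ s₀ a) * (r s₀ a i + γ * ∑ s', P s₀ a s' * W s' i) := by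
  have hM0 : ∀ s t, 0 ≤ ∑ a, ρ' s a * P s a t := fun s t =>
    Finset.sum_nonneg fun a _ => mul_nonneg (hρ'.1 s a) (hP0 s a t)
  have hM1 : ∀ s, ∑ t, ∑ a, ρ' s a * P s a t = 1 := fun s => by
    rw [Finset.sum_comm]
    simp_rw [← Finset.mul_sum, hP1, mul_one]
    exact hρ'.2 s
  obtain ⟨n, hn, H⟩ := exists_pos_visits hM0 hM1 hγ0 hγ1 hμ s₀
  refine ⟨n, hn, fun i => ?_⟩
  have expand : ∀ (σ : S → A → ℝ) (U : S → Fin D → ℝ) (s : S),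
      ∑ t, (∑ a, σ s a * P s a t) * U t i = ∑ a, σ s a * ∑ t, P s a t * U t i := by
    intro σ U s
    simp_rw [Finset.sum_mul, Finset.mul_sum]
    rw [Finset.sum_comm]
    simp_rw [mul_assoc]
  have hWi : ∀ s, W s i = ∑ a, ρ s a * r s a i + γ * ∑ t, (∑ a, ρ s a * P s a t) * W t i :=
    fun s => by simpa [Finset.sum_apply] using congrFun (hW s) i
  have hWi' : ∀ s, W' s i =
      ∑ a, ρ' s a * r s a i + γ * ∑ t, (∑ a, ρ' s a * P s a t) * W' t i :=
    fun s => by simpa [Finset.sum_apply] using congrFun (hW' s) i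
  have hdiff : ∀ s, ∑ t, (∑ a, ρ' s a * P s a t) * (W' t i - W t i) =
      ∑ t, (∑ a, ρ' s a * P s a t) * W' t i - ∑ t, (∑ a, ρ' s a * P s a t) * W t i :=
    fun s => by simp_rw [mul_sub, Finset.sum_sub_distrib]
  have key := H (fun s => W' s i - W s i)
    (∑ a, (ρ' s₀ a - ρ s₀ a) * (r s₀ a i + γ * ∑ s', P s₀ a s' * W s' i)) ?_ ?_
  · rw [← key]
    simp [Finset.sum_apply, mul_sub, Finset.sum_sub_distrib]
  · have hQ : ∑ a, (ρ' s₀ a - ρ s₀ a) * (r s₀ a i + γ * ∑ s', P s₀ a s' * W s' i) =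
        ∑ a, ρ' s₀ a * r s₀ a i - ∑ a, ρ s₀ a * r s₀ a i +
        γ * (∑ a, ρ' s₀ a * ∑ t, P s₀ a t * W t i - ∑ a, ρ s₀ a * ∑ t, P s₀ a t * W t i) := by
      rw [mul_sub, Finset.mul_sum, Finset.mul_sum, ← Finset.sum_sub_distrib,
        ← Finset.sum_sub_distrib, ← Finset.sum_add_distrib]
      exact Finset.sum_congr rfl fun a _ => by ring
    rw [hdiff, hQ, ← expand ρ', ← expand ρ]
    linear_combination hWi' s₀ - hWi s₀
  · intro s hs
    have h1 := hWi' s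
    have h2 := hWi s
    rw [hdiff]
    rw [← hoff s hs] at h2
    linear_combination h1 - h2

/-- Mixing two policies at a single state yields a return strictly between theirs. -/
theorem return_mem_openSegment_of_mix {S A : Type*} [Fintype S] [Fintype A] {D : ℕ}
    {P : S → A → S → ℝ} (hP0 : ∀ s a s', 0 ≤ P s a s') (hP1 : ∀ s a, ∑ s', P s a s' = 1)
    {r : S → A → Fin D → ℝ} {γ : ℝ} (hγ0 : 0 ≤ γ) (hγ1 : γ < 1)
    {μ : S → ℝ} (hμ : ∀ s, 0 < μ s)
    {V : (S → A → ℝ) → S → Fin D → ℝ}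
    (hV : ∀ π : S → A → ℝ, IsPolicy π → ∀ s,
      V π s = (∑ a, π s a • r s a) + γ • ∑ s', (∑ a, π s a * P s a s') • V π s')
    {ρ ρ₁ ρ₂ : S → A → ℝ} (hρ : IsPolicy ρ) (hρ₁ : IsPolicy ρ₁) (hρ₂ : IsPolicy ρ₂) {s₀ : S}
    (hoff₁ : ∀ s, s ≠ s₀ → ρ₁ s = ρ s) (hoff₂ : ∀ s, s ≠ s₀ → ρ₂ s = ρ s)
    {p : ℝ} (hp0 : 0 < p) (hp1 : p < 1)
    (hmix : ∀ a, ρ s₀ a = p * ρ₁ s₀ a + (1 - p) * ρ₂ s₀ a) :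
    ∑ s, μ s • V ρ s ∈ openSegment ℝ (∑ s, μ s • V ρ₁ s) (∑ s, μ s • V ρ₂ s) := by
  obtain ⟨n₁, hn₁, h₁⟩ := exists_pos_performance_difference hP0 hP1 hγ0 hγ1 hμ hρ₁
    (hV ρ hρ) (hV ρ₁ hρ₁) hoff₁
  obtain ⟨n₂, hn₂, h₂⟩ := exists_pos_performance_difference hP0 hP1 hγ0 hγ1 hμ hρ₂
    (hV ρ hρ) (hV ρ₂ hρ₂) hoff₂
  have hq : 0 < 1 - p := by linarith
  have hc : 0 < p * n₂ + (1 - p) * n₁ := by positivity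
  refine ⟨p * n₂ / (p * n₂ + (1 - p) * n₁), (1 - p) * n₁ / (p * n₂ + (1 - p) * n₁),
    by positivity, by positivity, by rw [← add_div, div_self hc.ne'], ?_⟩
  funext i
  have hzero : p * ∑ a, (ρ₁ s₀ a - ρ s₀ a) * (r s₀ a i + γ * ∑ s', P s₀ a s' * V ρ s' i) +
      (1 - p) * ∑ a, (ρ₂ s₀ a - ρ s₀ a) * (r s₀ a i + γ * ∑ s', P s₀ a s' * V ρ s' i) = 0 := by
    rw [Finset.mul_sum, Finset.mul_sum, ← Finset.sum_add_distrib]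
    refine Finset.sum_eq_zero fun a _ => ?_
    rw [hmix a]
    ring
  simp only [Pi.add_apply, Pi.smul_apply, smul_eq_mul]
  have e₁ := h₁ i
  have e₂ := h₂ i
  field_simp
  linear_combination p * n₂ * e₁ + (1 - p) * n₁ * e₂ + n₁ * n₂ * hzero

/-- Prescribing a distribution over actions at one state of a policy gives a policy. -/
theorem IsPolicy.update {S A : Type*} [Fintype A] [DecidableEq S] {ρ : S → A → ℝ}
    (hρ : IsPolicy ρ) (s₀ : S) {q : A → ℝ} (hq0 : ∀ a, 0 ≤ q a) (hq1 : ∑ a, q a = 1) :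
    IsPolicy (Function.update ρ s₀ q) := by
  constructor
  · intro s a
    by_cases h : s = s₀
    · subst h; simpa using hq0 a
    · simpa [h] using hρ.1 s a
  · intro s
    by_cases h : s = s₀
    · subst h; simpa using hq1
    · simpa [h] using hρ.2 s

/-- A policy whose return is an extreme point can be made deterministic at any given state
without changing its return. -/
theorem exists_update_single_return_eq {S A : Type*} [Fintype S] [Fintype A]
    [DecidableEq S] [DecidableEq A] {D : ℕ}
    {P : S → A → S → ℝ} (hP0 : ∀ s a s', 0 ≤ P s a s') (hP1 : ∀ s a, ∑ s', P s a s' = 1)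
    {r : S → A → Fin D → ℝ} {γ : ℝ} (hγ0 : 0 ≤ γ) (hγ1 : γ < 1)
    {μ : S → ℝ} (hμ : ∀ s, 0 < μ s)
    {V : (S → A → ℝ) → S → Fin D → ℝ}
    (hV : ∀ π : S → A → ℝ, IsPolicy π → ∀ s,
      V π s = (∑ a, π s a • r s a) + γ • ∑ s', (∑ a, π s a * P s a s') • V π s')
    {ρ : S → A → ℝ} (hρ : IsPolicy ρ)
    (hext : ∑ s, μ s • V ρ s ∈ Set.extremePoints ℝ
      {x | ∃ π, IsPolicy π ∧ x = ∑ s, μ s • V π s}) (s₀ : S) :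
    ∃ a : A, IsPolicy (Function.update ρ s₀ (Pi.single a 1)) ∧
      ∑ s, μ s • V (Function.update ρ s₀ (Pi.single a 1)) s = ∑ s, μ s • V ρ s := by
  obtain ⟨a, -, ha⟩ : ∃ a ∈ Finset.univ, 0 < ρ s₀ a :=
    Finset.exists_lt_of_sum_lt (f := fun _ => (0 : ℝ)) (by simp [hρ.2 s₀])
  have hsingle : ∀ b, (0 : ℝ) ≤ (Pi.single a (1 : ℝ) : A → ℝ) b := fun b => by
    by_cases h : b = a
    · subst h; simp
    · simp [h]
  have hpol₁ : IsPolicy (Function.update ρ s₀ (Pi.single a 1)) :=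
    hρ.update s₀ hsingle (by simp)
  refine ⟨a, hpol₁, ?_⟩
  have hsplit : ρ s₀ a + ∑ b ∈ Finset.univ.erase a, ρ s₀ b = 1 := by
    rw [Finset.add_sum_erase _ _ (Finset.mem_univ a), hρ.2 s₀]
  have hle : ρ s₀ a ≤ 1 := by
    have := Finset.sum_nonneg (s := Finset.univ.erase a) fun b _ => hρ.1 s₀ b
    linarith
  rcases hle.lt_or_eq with hlt | heq
  · have hq : 0 < 1 - ρ s₀ a := by linarith
    let q : A → ℝ := fun b => (ρ s₀ b - ρ s₀ a * (Pi.single a (1 : ℝ) : A → ℝ) b) / (1 - ρ s₀ a)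
    have hpol₂ : IsPolicy (Function.update ρ s₀ q) := by
      refine hρ.update s₀ (fun b => div_nonneg ?_ hq.le) ?_
      · by_cases h : b = a
        · subst h; simp
        · simpa [h] using hρ.1 s₀ b
      · simp only [q]
        rw [← Finset.sum_div, Finset.sum_sub_distrib, ← Finset.mul_sum, hρ.2 s₀]
        simp [hq.ne']
    have hmem := return_mem_openSegment_of_mix hP0 hP1 hγ0 hγ1 hμ hV hρ hpol₁ hpol₂ (s₀ := s₀)
      (fun s hs => Function.update_of_ne hs _ _) (fun s hs => Function.update_of_ne hs _ _) ha hlt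
      (fun b => by
        simp only [Function.update_self, q]
        field_simp
        ring)
    exact hext.2 ⟨_, hpol₁, rfl⟩ ⟨_, hpol₂, rfl⟩ hmem
  · have hzero : ∀ b, b ≠ a → ρ s₀ b = 0 := fun b hb => by
      have h0 : ∑ b ∈ Finset.univ.erase a, ρ s₀ b = 0 := by linarith
      exact (Finset.sum_eq_zero_iff_of_nonneg fun b _ => hρ.1 s₀ b).1 h0 b (by simp [hb])
    have : Pi.single a 1 = ρ s₀ := by
      funext b
      by_cases h : b = a
      · subst h; simp [heq]
      · simp [h, hzero b h]
    rw [this, Function.update_eq_self]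

/-- Every extreme point of the set of returns is attained by a deterministic policy. -/
theorem exists_isDetPolicy_return_eq {S A : Type*} [Fintype S] [Fintype A] {D : ℕ}
    {P : S → A → S → ℝ} (hP0 : ∀ s a s', 0 ≤ P s a s') (hP1 : ∀ s a, ∑ s', P s a s' = 1)
    {r : S → A → Fin D → ℝ} {γ : ℝ} (hγ0 : 0 ≤ γ) (hγ1 : γ < 1)
    {μ : S → ℝ} (hμ : ∀ s, 0 < μ s)
    {V : (S → A → ℝ) → S → Fin D → ℝ}
    (hV : ∀ π : S → A → ℝ, IsPolicy π → ∀ s,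
      V π s = (∑ a, π s a • r s a) + γ • ∑ s', (∑ a, π s a * P s a s') • V π s')
    {v : Fin D → ℝ}
    (hext : v ∈ Set.extremePoints ℝ {x | ∃ π, IsPolicy π ∧ x = ∑ s, μ s • V π s}) :
    ∃ u : S → A → ℝ, IsDetPolicy u ∧ ∑ s, μ s • V u s = v := by
  classical
  have H : ∀ F : Finset S, ∃ u : S → A → ℝ, IsPolicy u ∧ (∀ s ∈ F, ∃ a, u s a = 1) ∧
      ∑ s, μ s • V u s = v := by
    intro F
    induction F using Finset.induction_on with
    | empty =>
      obtain ⟨ρ, hρ, h⟩ := hext.1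
      exact ⟨ρ, hρ, by simp, h.symm⟩
    | insert s₀ F _ ih =>
      obtain ⟨u, hu, hdet, hv⟩ := ih
      obtain ⟨a, hpol, hret⟩ := exists_update_single_return_eq hP0 hP1 hγ0 hγ1 hμ hV hu
        (by rw [hv]; exact hext) s₀
      refine ⟨_, hpol, fun s hs => ?_, hret.trans hv⟩
      by_cases h : s = s₀
      · subst h
        exact ⟨a, by simp⟩
      · obtain ⟨b, hb⟩ := hdet s ((Finset.mem_insert.1 hs).resolve_left h)
        exact ⟨b, by simpa [h] using hb⟩
  obtain ⟨u, hu, hdet, hv⟩ := H Finset.univ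
  exact ⟨u, ⟨hu, fun s => hdet s (Finset.mem_univ s)⟩, hv⟩

/-- If a linear functional is at most `c` on `T` and the points of `T` where it equals `c` lie in a
convex set, then so do those of the convex hull of `T`. -/
theorem mem_of_mem_convexHull_of_eq {E : Type*} [AddCommGroup E] [Module ℝ E] {T F : Set E}
    (f : E →ₗ[ℝ] ℝ) {c : ℝ} (hF : Convex ℝ F) (hle : ∀ y ∈ T, f y ≤ c)
    (heq : ∀ y ∈ T, f y = c → y ∈ F) :
    ∀ y ∈ convexHull ℝ T, f y ≤ c ∧ (f y = c → y ∈ F) := by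
  have hconv : Convex ℝ {y | f y ≤ c ∧ (f y = c → y ∈ F)} := by
    intro x hx y hy a b ha hb hab
    have hx' := mul_le_mul_of_nonneg_left hx.1 ha
    have hy' := mul_le_mul_of_nonneg_left hy.1 hb
    have hc : a * c + b * c = c := by rw [← add_mul, hab, one_mul]
    simp only [Set.mem_ofPred_eq, map_add, map_smul, smul_eq_mul]
    refine ⟨by linarith, fun h => ?_⟩
    rcases ha.eq_or_lt with rfl | ha
    · obtain rfl : b = 1 := by linarith
      simp only [zero_smul, one_smul, zero_add]
      exact hy.2 (by linarith)
    rcases hb.eq_or_lt with rfl | hb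
    · obtain rfl : a = 1 := by linarith
      simp only [zero_smul, one_smul, add_zero]
      exact hx.2 (by linarith)
    · refine hF (hx.2 ?_) (hy.2 ?_) ha.le hb.le hab
      · exact mul_left_cancel₀ ha.ne' (by linarith)
      · exact mul_left_cancel₀ hb.ne' (by linarith)
  have hT : T ⊆ {y | f y ≤ c ∧ (f y = c → y ∈ F)} := fun y hy => ⟨hle y hy, heq y hy⟩
  exact fun y hy => convexHull_min hT hconv hy

/-- The right endpoint of a segment is an extreme point of the segment. -/
theorem right_mem_extremePoints_segment {E : Type*} [AddCommGroup E] [Module ℝ E] (x v : E) :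
    v ∈ (segment ℝ x v).extremePoints ℝ := by
  refine ⟨right_mem_segment ℝ x v, ?_⟩
  rintro _ ⟨a₁, b₁, ha₁, -, hab₁, rfl⟩ _ ⟨a₂, b₂, ha₂, -, hab₂, rfl⟩ ⟨a, b, ha, hb, hab, h⟩
  obtain rfl : b₁ = 1 - a₁ := by linarith
  obtain rfl : b₂ = 1 - a₂ := by linarith
  obtain rfl : b = 1 - a := by linarith
  have h0 : (a * a₁ + (1 - a) * a₂) • (x - v) = 0 := by
    rw [← sub_eq_zero] at h
    rw [← h]
    module
  rcases smul_eq_zero.1 h0 with h0 | h0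
  · have h1 : 0 ≤ a * a₁ := mul_nonneg ha.le ha₁
    have h2 : 0 ≤ (1 - a) * a₂ := mul_nonneg hb.le ha₂
    have h3 : a₁ = 0 := (mul_eq_zero.1 (by linarith : a * a₁ = 0)).resolve_left ha.ne'
    simp [h3]
  · rw [sub_eq_zero.1 h0, ← add_smul, hab₁, one_smul]

/-- A segment that is a face of `C` is a face of the convex hull of any subset of `C` containing
its endpoints, and its right endpoint is an extreme point of that hull. -/
theorem IsFaceOf.segment_convexHull {D : ℕ} {C T : Set (Fin D → ℝ)} {x v : Fin D → ℝ}
    (h : IsFaceOf (segment ℝ x v) C) (hT : T ⊆ C) (hx : x ∈ T) (hv : v ∈ T) :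
    v ∈ (convexHull ℝ T).extremePoints ℝ ∧ IsFaceOf (segment ℝ x v) (convexHull ℝ T) := by
  obtain ⟨w, c, hle, heq⟩ := h
  let f : (Fin D → ℝ) →ₗ[ℝ] ℝ := ∑ i, w i • LinearMap.proj i
  have hf : ∀ y, f y = ∑ i, w i * y i := fun y => by simp [f]
  have hmem : ∀ y ∈ segment ℝ x v, f y = c := fun y hy => by
    rw [heq] at hy
    rw [hf]
    exact hy.2
  have key := mem_of_mem_convexHull_of_eq f (T := T) (convex_segment x v)
    (fun y hy => by rw [hf]; exact hle y (hT hy))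
    (fun y hy hyc => by rw [heq]; exact ⟨hT hy, by rw [← hyc, hf]; rfl⟩)
  have hsub : segment ℝ x v ⊆ convexHull ℝ T :=
    (convex_convexHull ℝ T).segment_subset (subset_convexHull ℝ T hx) (subset_convexHull ℝ T hv)
  refine ⟨⟨subset_convexHull ℝ T hv, ?_⟩, w, c, fun y hy => ?_, ?_⟩
  · intro y hy z hz hyz
    obtain ⟨a, b, ha, hb, hab, hyzv⟩ := id hyz
    have hfv := hmem _ (right_mem_segment ℝ x v)
    rw [← hyzv] at hfv
    simp only [map_add, map_smul, smul_eq_mul] at hfv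
    have hc : a * c + b * c = c := by rw [← add_mul, hab, one_mul]
    have hy' := mul_le_mul_of_nonneg_left (key y hy).1 ha.le
    have hz' := mul_le_mul_of_nonneg_left (key z hz).1 hb.le
    have hyS := (key y hy).2 (mul_left_cancel₀ ha.ne' (by linarith))
    have hzS := (key z hz).2 (mul_left_cancel₀ hb.ne' (by linarith))
    exact ((mem_extremePoints.1 (right_mem_extremePoints_segment x v)).2 y hyS z hzS hyz).1
  · rw [← hf]
    exact (key y hy).1
  · ext y
    constructor
    · intro hy
      exact ⟨hsub hy, by rw [Set.mem_ofPred_eq, ← hf]; exact hmem y hy⟩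
    · rintro ⟨hy, hyc⟩
      exact (key y hy).2 (by rw [hf]; exact hyc)

/-- Every Pareto neighbouring vertex of `J^π(μ)` on `J(μ)` is also a neighbouring vertex of
`J^π(μ)` on the local convex hull `K_ND` built from non-dominated distance-one policies. -/
theorem pareto_neighbours_in_local_nondominated_hull
    {S A : Type*} [Fintype S] [Fintype A] [Nonempty S] [Nonempty A]
    {D : ℕ} (hD : 1 ≤ D)
    (P : S → A → S → ℝ)
    (hP0 : ∀ s a s', 0 ≤ P s a s') (hP1 : ∀ s a, ∑ s', P s a s' = 1)
    (r : S → A → Fin D → ℝ)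
    (γ : ℝ) (hγ0 : 0 ≤ γ) (hγ1 : γ < 1)
    (μ : S → ℝ) (hμpos : ∀ s, 0 < μ s) (hμ1 : ∑ s, μ s = 1)
    (V : (S → A → ℝ) → S → Fin D → ℝ)
    (hV : ∀ π : S → A → ℝ, IsPolicy π → ∀ s,
      V π s = (∑ a, π s a • r s a) + γ • ∑ s', (∑ a, π s a * P s a s') • V π s')
    (J : (S → A → ℝ) → Fin D → ℝ) (hJ : ∀ π, J π = ∑ s, μ s • V π s)
    (Jset : Set (Fin D → ℝ))
    (hJset : Jset = {x | ∃ π, IsPolicy π ∧ x = J π})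
    (π : S → A → ℝ) (hπ : IsDetPolicy π)
    (hext : J π ∈ Jset.extremePoints ℝ)
    (hpar : ParetoOptimalIn (J π) Jset)
    (Pol1 : Set (S → A → ℝ))
    (hPol1 : Pol1 = {u | IsDetPolicy u ∧ DiffersAtExactlyOneState u π})
    (hdist1 : ∀ u : S → A → ℝ, IsDetPolicy u → J u ≠ J π →
      IsFaceOf (segment ℝ (J u) (J π)) Jset → u ∈ Pol1)
    (Pol1ND : Set (S → A → ℝ))
    (hPol1ND : Pol1ND = {u | u ∈ Pol1 ∧ ¬ ∃ u' ∈ Pol1, StrictlyDominates (J u') (J u)})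
    (KND : Set (Fin D → ℝ)) (hKND : KND = convexHull ℝ ((J '' Pol1ND) ∪ {J π})) :
    ∀ v : Fin D → ℝ, v ∈ Jset.extremePoints ℝ →
      IsFaceOf (segment ℝ (J π) v) Jset →
      (∀ z ∈ segment ℝ (J π) v, ParetoOptimalIn z Jset) →
      v ∈ KND.extremePoints ℝ ∧ IsFaceOf (segment ℝ (J π) v) KND := by
  intro v hv hface hvpar
  have hJset' : Jset = {x | ∃ π, IsPolicy π ∧ x = ∑ s, μ s • V π s} := by
    simp only [hJset, hJ]
  obtain ⟨u, hu, huv⟩ := exists_isDetPolicy_return_eq hP0 hP1 hγ0 hγ1 hμpos hV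
    (by rw [← hJset']; exact hv)
  rw [← hJ] at huv
  have hPolJ : ∀ ρ ∈ Pol1, J ρ ∈ Jset := fun ρ hρ => by
    rw [hPol1] at hρ
    rw [hJset]
    exact ⟨ρ, hρ.1.1, rfl⟩
  have hvT : v ∈ (J '' Pol1ND) ∪ {J π} := by
    by_cases h : J u = J π
    · exact Or.inr (huv.symm.trans h)
    · left
      refine ⟨u, ?_, huv⟩
      rw [hPol1ND]
      refine ⟨hdist1 u hu h (by rw [huv, segment_symm]; exact hface), ?_⟩
      rintro ⟨u', hu', hdom⟩
      rw [huv] at hdom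
      exact hvpar v (right_mem_segment ℝ _ _) _ (hPolJ u' hu') hdom
  rw [hKND]
  refine hface.segment_convexHull ?_ (Or.inr rfl) hvT
  rintro _ (⟨ρ, hρ, rfl⟩ | rfl)
  · rw [hPol1ND] at hρ
    exact hPolJ ρ hρ.1
  · exact hext.1
end

section
/- Consider a finite discounted single-objective MDP (reward dimension D = 1). Call a stationary policy π optimal if V^{π}(s) ≥ V^{u}(s) for every stationary policy u and every state s, and let Π* be the set of optimal deterministic stationary policies. Then a stationary policy π is optimal if and only if π belongs to the convex hull of Π*, where policies are viewed as vectors in ℝ^{S × A} and a convex combination π = Σ_i α_i π_i (α_i ≥ 0, Σ_i α_i = 1) is taken pointwise: π(s,a) = Σ_i α_i π_i(s,a). -/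
open Finset

/-- The value of playing `a` at `s` once and then collecting the continuation value `W`. -/
def actionValue {S A : Type*} [Fintype S] (P : S → A → S → ℝ) (r : S → A → ℝ) (γ : ℝ)
    (W : S → ℝ) (s : S) (a : A) : ℝ :=
  r s a + γ * ∑ s', P s a s' * W s'

/-- The policy evaluation operator of `u`. -/
def policyEval {S A : Type*} [Fintype S] [Fintype A] (P : S → A → S → ℝ) (r : S → A → ℝ)
    (γ : ℝ) (u : S → A → ℝ) (W : S → ℝ) (s : S) : ℝ :=
  ∑ a, u s a * actionValue P r γ W s a

lemma IsPolicy.update_single {S A : Type*} [Fintype A] {π : S → A → ℝ} [DecidableEq S]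
    [DecidableEq A] (hπ : IsPolicy π) (s : S) (a : A) :
    IsPolicy (Function.update π s (Pi.single a 1)) := by
  refine ⟨fun t b => ?_, fun t => ?_⟩ <;> rcases eq_or_ne t s with rfl | ht
  · simp only [Function.update_self, Pi.single_apply]
    split_ifs <;> norm_num
  · simpa [ht] using hπ.1 t b
  · simp
  · simpa [ht] using hπ.2 t

section PolicyEval

variable {S A : Type*} [Fintype S] {P : S → A → S → ℝ} {r : S → A → ℝ} {γ : ℝ}
  {u π : S → A → ℝ}

lemma actionValue_mono (hP0 : ∀ s a s', 0 ≤ P s a s') (hγ0 : 0 ≤ γ) {W W' : S → ℝ}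
    (h : ∀ s, W s ≤ W' s) (s : S) (a : A) :
    actionValue P r γ W s a ≤ actionValue P r γ W' s a := by
  unfold actionValue
  gcongr with s' _
  · exact hP0 s a s'
  · exact h s'

lemma actionValue_add_const (hP1 : ∀ s a, ∑ s', P s a s' = 1) (W : S → ℝ) (c : ℝ) (s : S)
    (a : A) : actionValue P r γ (fun s => W s + c) s a = actionValue P r γ W s a + γ * c := by
  simp only [actionValue, mul_add, sum_add_distrib, ← sum_mul, hP1]
  ring

variable [Fintype A]

lemma policyEval_eq (P : S → A → S → ℝ) (r : S → A → ℝ) (γ : ℝ) (u : S → A → ℝ) (W : S → ℝ)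
    (s : S) : policyEval P r γ u W s =
      (∑ a, u s a * r s a) + γ * ∑ s', (∑ a, u s a * P s a s') * W s' := by
  simp only [policyEval, actionValue, mul_add, sum_add_distrib, sum_mul, mul_sum]
  congr 1
  rw [sum_comm]
  exact sum_congr rfl fun _ _ => sum_congr rfl fun _ _ => by ring

lemma policyEval_mono (hP0 : ∀ s a s', 0 ≤ P s a s') (hγ0 : 0 ≤ γ) (hu : IsPolicy u)
    {W W' : S → ℝ} (h : ∀ s, W s ≤ W' s) (s : S) :
    policyEval P r γ u W s ≤ policyEval P r γ u W' s :=
  sum_le_sum fun a _ => mul_le_mul_of_nonneg_left (actionValue_mono hP0 hγ0 h s a) (hu.1 s a)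

lemma policyEval_add_const (hP1 : ∀ s a, ∑ s', P s a s' = 1) (hu : IsPolicy u) (W : S → ℝ)
    (c : ℝ) (s : S) :
    policyEval P r γ u (fun s => W s + c) s = policyEval P r γ u W s + γ * c := by
  simp only [policyEval, actionValue_add_const hP1, mul_add (u _ _), sum_add_distrib, ← sum_mul,
    hu.2, one_mul]

/-- A subsolution of the policy evaluation equation lies below any supersolution. -/
lemma le_of_le_policyEval_of_policyEval_le (hP0 : ∀ s a s', 0 ≤ P s a s')
    (hP1 : ∀ s a, ∑ s', P s a s' = 1) (hγ0 : 0 ≤ γ) (hγ1 : γ < 1) (hu : IsPolicy u)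
    {W W' : S → ℝ} (hW : ∀ s, W s ≤ policyEval P r γ u W s)
    (hW' : ∀ s, policyEval P r γ u W' s ≤ W' s) (s : S) : W s ≤ W' s := by
  have : Nonempty S := ⟨s⟩
  obtain ⟨m, hm⟩ := Finite.exists_max fun s => W s - W' s
  have hle : ∀ t, W t ≤ W' t + (W m - W' m) := fun t => by linarith [hm t]
  have hmono := policyEval_mono (r := r) hP0 hγ0 hu hle m
  rw [policyEval_add_const hP1 hu] at hmono
  have hmax : W m - W' m ≤ 0 := by nlinarith [hW m, hW' m]
  linarith [hm s]

lemma policyEval_le (hu : IsPolicy u) {W : S → ℝ} {s : S} {c : ℝ}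
    (h : ∀ a, actionValue P r γ W s a ≤ c) : policyEval P r γ u W s ≤ c :=
  calc policyEval P r γ u W s ≤ ∑ a, u s a * c :=
        sum_le_sum fun a _ => mul_le_mul_of_nonneg_left (h a) (hu.1 s a)
    _ = c := by rw [← sum_mul, hu.2, one_mul]

/-- The Bellman optimality inequality: no one-step deviation improves on an optimal policy. -/
lemma actionValue_le_of_optimal (hP0 : ∀ s a s', 0 ≤ P s a s')
    (hP1 : ∀ s a, ∑ s', P s a s' = 1) (hγ0 : 0 ≤ γ) (hγ1 : γ < 1)
    {V : (S → A → ℝ) → S → ℝ} (hV : ∀ u, IsPolicy u → ∀ s, V u s = policyEval P r γ u (V u) s)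
    (hπ : IsPolicy π) (hopt : ∀ u, IsPolicy u → ∀ s, V u s ≤ V π s) (s : S) (a : A) :
    actionValue P r γ (V π) s a ≤ V π s := by
  classical
  by_contra! hlt
  set u := Function.update π s (Pi.single a 1) with hu_def
  have hu : IsPolicy u := hπ.update_single s a
  have hus : policyEval P r γ u (V π) s = actionValue P r γ (V π) s a := by
    simp [policyEval, hu_def, Pi.single_apply]
  have hsub : ∀ t, V π t ≤ policyEval P r γ u (V π) t := fun t => by
    rcases eq_or_ne t s with rfl | ht
    · exact hus ▸ hlt.le
    · have : policyEval P r γ u (V π) t = policyEval P r γ π (V π) t := by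
        simp [policyEval, hu_def, ht]
      rw [this, ← hV π hπ]
  have himp : ∀ t, V π t ≤ V u t :=
    le_of_le_policyEval_of_policyEval_le hP0 hP1 hγ0 hγ1 hu hsub fun t => (hV u hu t).ge
  linarith [policyEval_mono (r := r) hP0 hγ0 hu himp s, hV u hu s, hopt u hu s]

lemma actionValue_eq_of_policyEval_eq (hu : IsPolicy u) {W : S → ℝ} {s : S} {c : ℝ}
    (h : ∀ a, actionValue P r γ W s a ≤ c) (heq : policyEval P r γ u W s = c) {a : A}
    (ha : u s a ≠ 0) : actionValue P r γ W s a = c := by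
  have hsum : ∑ b, u s b * (c - actionValue P r γ W s b) = 0 := by
    simp only [mul_sub, sum_sub_distrib, ← sum_mul, hu.2, one_mul]
    exact sub_eq_zero.2 heq.symm
  have hzero := (sum_eq_zero_iff_of_nonneg fun b _ =>
    mul_nonneg (hu.1 s b) (sub_nonneg.2 (h b))).1 hsum a (mem_univ a)
  linarith [(mul_eq_zero.1 hzero).resolve_left ha]

lemma convex_setOf_isPolicy_policyEval_eq (W : S → ℝ) :
    Convex ℝ {u : S → A → ℝ | IsPolicy u ∧ ∀ s, policyEval P r γ u W s = W s} := by
  rintro u ⟨hu, huW⟩ v ⟨hv, hvW⟩ α β hα hβ hαβ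
  refine ⟨⟨fun s a => ?_, fun s => ?_⟩, fun s => ?_⟩
  · exact add_nonneg (mul_nonneg hα (hu.1 s a)) (mul_nonneg hβ (hv.1 s a))
  · simp [sum_add_distrib, ← mul_sum, hu.2, hv.2, hαβ]
  · have : policyEval P r γ (α • u + β • v) W s =
        α * policyEval P r γ u W s + β * policyEval P r γ v W s := by
      simp [policyEval, add_mul, sum_add_distrib, mul_sum, mul_assoc]
    rw [this, huW, hvW, ← add_mul, hαβ, one_mul]

end PolicyEval

/-- A probability vector is a convex combination of the vertices in its support. -/
lemma mem_convexHull_single_of_support {A : Type*} [Fintype A] [DecidableEq A] {p : A → ℝ}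
    (hp0 : ∀ a, 0 ≤ p a) (hp1 : ∑ a, p a = 1) {T : Set A} (hT : ∀ a, p a ≠ 0 → a ∈ T) :
    p ∈ convexHull ℝ ((fun a => Pi.single a (1 : ℝ)) '' T) := by
  have hp : ∑ a with p a ≠ 0, p a • (Pi.single a (1 : ℝ) : A → ℝ) = p := by
    rw [sum_filter_of_ne fun a _ h => left_ne_zero_of_smul h]
    ext b
    simp [Finset.sum_apply, Pi.single_apply]
  rw [← hp]
  refine (convex_convexHull ℝ _).sum_mem (fun a _ => hp0 a) ?_ fun a ha => ?_
  · rw [sum_filter_ne_zero, hp1]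
  · exact subset_convexHull ℝ _ ⟨a, hT a (mem_filter.1 ha).2, rfl⟩

/-- In a finite discounted single-objective MDP, a stationary policy is optimal (at every
state) if and only if it lies in the convex hull of the set of optimal deterministic
stationary policies (policies viewed as vectors, convex combinations taken pointwise). -/
theorem optimal_iff_mem_convexHull_of_det_optimal
    {S A : Type*} [Fintype S] [Fintype A] [Nonempty S] [Nonempty A]
    (P : S → A → S → ℝ)
    (hP0 : ∀ s a s', 0 ≤ P s a s') (hP1 : ∀ s a, ∑ s', P s a s' = 1)
    (r : S → A → ℝ)
    (γ : ℝ) (hγ0 : 0 ≤ γ) (hγ1 : γ < 1)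
    (V : (S → A → ℝ) → S → ℝ)
    (hV : ∀ π : S → A → ℝ, IsPolicy π → ∀ s,
      V π s = (∑ a, π s a * r s a) + γ * ∑ s', (∑ a, π s a * P s a s') * V π s')
    (PiStar : Set (S → A → ℝ))
    (hPiStar : PiStar = {π | IsDetPolicy π ∧ ∀ u : S → A → ℝ, IsPolicy u → ∀ s, V u s ≤ V π s}) :
    ∀ π : S → A → ℝ, IsPolicy π →
      ((∀ u : S → A → ℝ, IsPolicy u → ∀ s, V u s ≤ V π s) ↔ π ∈ convexHull ℝ PiStar) := by
  classical
  subst hPiStar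
  intro π hπ
  replace hV : ∀ u, IsPolicy u → ∀ s, V u s = policyEval P r γ u (V u) s := fun u hu s =>
    (hV u hu s).trans (policyEval_eq P r γ u (V u) s).symm
  have value_eq : ∀ {u : S → A → ℝ} {W : S → ℝ}, IsPolicy u →
      (∀ s, policyEval P r γ u W s = W s) → ∀ s, V u s = W s := fun hu h s =>
    le_antisymm
      (le_of_le_policyEval_of_policyEval_le hP0 hP1 hγ0 hγ1 hu (fun t => (hV _ hu t).le)
        (fun t => (h t).le) s)
      (le_of_le_policyEval_of_policyEval_le hP0 hP1 hγ0 hγ1 hu (fun t => (h t).ge)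
        (fun t => (hV _ hu t).ge) s)
  constructor
  · intro hopt
    have hQ := actionValue_le_of_optimal hP0 hP1 hγ0 hγ1 hV hπ hopt
    set greedy : S → Set A := fun s => {a | actionValue P r γ (V π) s a = V π s}
    have hmem : π ∈ convexHull ℝ (Set.univ.pi fun s =>
        (fun a => (Pi.single a (1 : ℝ) : A → ℝ)) '' greedy s) := by
      rw [convexHull_pi]
      exact fun s _ => mem_convexHull_single_of_support (hπ.1 s) (hπ.2 s) fun a ha =>
        actionValue_eq_of_policyEval_eq hπ (hQ s) (hV π hπ s).symm ha
    refine convexHull_mono (fun d hd => ?_) hmem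
    choose f hf hfd using fun s => hd s (Set.mem_univ s)
    obtain rfl : (fun s => Pi.single (f s) (1 : ℝ)) = d := funext hfd
    have hd : IsPolicy fun s => (Pi.single (f s) (1 : ℝ) : A → ℝ) :=
      ⟨fun s a => by simp only [Pi.single_apply]; split_ifs <;> norm_num, fun s => by simp⟩
    refine ⟨⟨hd, fun s => ⟨f s, Pi.single_eq_same _ _⟩⟩, fun u hu s => ?_⟩
    rw [value_eq hd (W := V π) fun t => ?_]
    · exact hopt u hu s
    · have hft : actionValue P r γ (V π) t (f t) = V π t := hf t
      simpa [policyEval, Pi.single_apply] using hft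
  · intro hmem
    obtain ⟨d, ⟨hd, -⟩, hdopt⟩ := convexHull_nonempty_iff.1 ⟨π, hmem⟩
    have hsub : {u | IsDetPolicy u ∧ ∀ v, IsPolicy v → ∀ s, V v s ≤ V u s} ⊆
        {u : S → A → ℝ | IsPolicy u ∧ ∀ s, policyEval P r γ u (V d) s = V d s} := by
      rintro u ⟨⟨hu, -⟩, huopt⟩
      have : V u = V d := funext fun s => le_antisymm (hdopt u hu s) (huopt d hd s)
      exact ⟨hu, fun s => by rw [← this, ← hV u hu]⟩
    have hfix := (convexHull_min hsub (convex_setOf_isPolicy_policyEval_eq (V d)) hmem).2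
    intro u hu s
    rw [value_eq hπ hfix]
    exact hdopt u hu s
end
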